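/- arXiv:1511.09448 — 2 statements merged into one kernel-verified Lean document; each statement's English description precedes it below -/
import Mathlib

section
/- Let p be an odd positive integer and q a positive integer. Let Q be the quadratic form Q(x) = x_1^2 + ... + x_p^2 - x_{p+1}^2 - ... - x_{p+q+1}^2 on ℝ^{p+q+1}, let X = {x ∈ ℝ^{p+q+1} : Q(x) = -1} with the subspace topology, and let O(p,q+1) = {A ∈ GL(p+q+1, ℝ) : Q(A x) = Q(x) for all x} act on X by matrix multiplication. Then there is no discrete subgroup Γ of O(p,q+1) that acts properly discontinuously and cocompactly on X. In other words, the pseudo-Riemannian hyperbolic space H^{p,q} of signature (p,q) and constant curvature -1 admits no compact Clifford–Klein form when p is odd. -/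
/-!
The pseudo-Riemannian hyperbolic space `H^{p,q}` of signature `(p,q)` admits no compact
Clifford–Klein form when `p` is odd.
-/

open Matrix

set_option maxHeartbeats 1000000
set_option synthInstance.maxHeartbeats 1000000

noncomputable section

/-- The quadratic form `Q(x) = x_1² + ⋯ + x_p² − x_{p+1}² − ⋯ − x_N²` on `ℝ^N`. -/
def Qpq (p N : ℕ) (x : Fin N → ℝ) : ℝ :=
  ∑ i : Fin N, if (i : ℕ) < p then (x i) ^ 2 else -((x i) ^ 2)

/-- The indefinite orthogonal group `O(p, N-p)`: the subgroup of `GL(N, ℝ)` of matrices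
preserving the quadratic form `Q`. -/
def Opq (p N : ℕ) : Subgroup (GL (Fin N) ℝ) where
  carrier := {A | ∀ x, Qpq p N (A.val *ᵥ x) = Qpq p N x}
  one_mem' := by
    intro x
    rw [Units.val_one, Matrix.one_mulVec]
  mul_mem' := by
    intro A B hA hB x
    rw [Units.val_mul, ← Matrix.mulVec_mulVec, hA, hB]
  inv_mem' := by
    intro A hA x
    have h := hA ((A⁻¹).val *ᵥ x)
    rw [Matrix.mulVec_mulVec, Units.mul_inv, Matrix.one_mulVec] at h
    exact h.symm

/-- The pseudo-Riemannian hyperbolic space `H^{p,q}` of signature `(p,q)`, realized as the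
quadric `{x ∈ ℝ^{p+q+1} : Q(x) = -1}` (with the subspace topology), where
`Q(x) = x_1² + ⋯ + x_p² − x_{p+1}² − ⋯ − x_{p+q+1}²`. -/
def Hpq (p N : ℕ) : Type := {x : Fin N → ℝ // Qpq p N x = -1}

instance (p N : ℕ) : TopologicalSpace (Hpq p N) :=
  inferInstanceAs (TopologicalSpace {x : Fin N → ℝ // Qpq p N x = -1})

/-- `O(p, N-p)` acts on the quadric `H^{p,q}` by matrix multiplication. -/
instance (p N : ℕ) : SMul ↥(Opq p N) (Hpq p N) :=
  ⟨fun A x => ⟨A.val.val *ᵥ x.val, by rw [A.prop x.val]; exact x.prop⟩⟩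

instance (p N : ℕ) : MulAction ↥(Opq p N) (Hpq p N) where
  one_smul x := by
    apply Subtype.ext
    show (1 : Matrix (Fin N) (Fin N) ℝ) *ᵥ x.val = x.val
    rw [Matrix.one_mulVec]
  mul_smul A B x := by
    apply Subtype.ext
    show ((A * B).val.val) *ᵥ x.val = A.val.val *ᵥ (B.val.val *ᵥ x.val)
    rw [Matrix.mulVec_mulVec]
    rfl

open Polynomial in
theorem exists_polynomial_eval_eq_det_one_add_smul {E : Type*} [NormedAddCommGroup E]
    [NormedSpace ℝ E] [FiniteDimensional ℝ E] (A : E →L[ℝ] E) :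
    ∃ P : ℝ[X], P.natDegree ≤ Module.finrank ℝ E ∧
      ∀ t : ℝ, P.eval t = (ContinuousLinearMap.id ℝ E + t • A).det := by
  let b := Module.finBasis ℝ E
  let M := LinearMap.toMatrix b b (A : E →ₗ[ℝ] E)
  refine ⟨det ((X : ℝ[X]) • M.map C + (1 : Matrix _ _ ℝ).map C), ?_, fun t => ?_⟩
  · simpa using natDegree_det_X_add_C_le M 1
  · rw [ContinuousLinearMap.det, ← LinearMap.det_toMatrix b, ← coe_evalRingHom, RingHom.map_det]
    congr 1
    have h : LinearMap.toMatrix b b (ContinuousLinearMap.id ℝ E + t • A : E →L[ℝ] E) =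
        1 + t • M := by
      simp [M]
    rw [h]
    ext i j
    simp only [RingHom.mapMatrix_apply, Matrix.map_apply, Matrix.add_apply, Matrix.smul_apply,
      coe_evalRingHom, smul_eq_mul, eval_add, eval_mul, eval_X, eval_C]
    ring

theorem det_id_add_pos {E : Type*} [NormedAddCommGroup E]
    [NormedSpace ℝ E] [FiniteDimensional ℝ E] (A : E →L[ℝ] E) (hA : ‖A‖ < 1) :
    0 < (ContinuousLinearMap.id ℝ E + A).det := by
  obtain ⟨P, -, hP⟩ := exists_polynomial_eval_eq_det_one_add_smul A
  have hne : ∀ t ∈ Set.Icc (0 : ℝ) 1, P.eval t ≠ 0 := by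
    intro t ht h0
    have hu : IsUnit (ContinuousLinearMap.id ℝ E + t • A) := by
      have : ‖-(t • A)‖ < 1 := by
        rw [norm_neg, norm_smul, Real.norm_of_nonneg ht.1]
        nlinarith [norm_nonneg A, ht.2]
      simpa using! isUnit_one_sub_of_norm_lt_one this
    have hu' := (hu.map (ContinuousLinearMap.toLinearMapRingHom (R₁ := ℝ) (M₁ := E))).map LinearMap.det
    rw [hP] at h0
    exact hu'.ne_zero h0
  by_contra! hneg
  have h1 : P.eval 1 ≤ 0 := by rw [hP, one_smul]; exact hneg
  have h0 : 0 ≤ P.eval 0 := by rw [hP]; simp [ContinuousLinearMap.det]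
  obtain ⟨t, ht, h⟩ := intermediate_value_Icc' zero_le_one P.continuous.continuousOn ⟨h1, h0⟩
  exact hne t ht h

open Polynomial in
theorem exists_polynomial_eval_eq_integral {α : Type*} [MeasurableSpace α]
    {μ : MeasureTheory.Measure α} (f : α → ℝ[X]) (n : ℕ) (hn : ∀ x, (f x).natDegree ≤ n)
    (hf : ∀ t, MeasureTheory.Integrable (fun x => (f x).eval t) μ) :
    ∃ P : ℝ[X], ∀ t, P.eval t = ∫ x, (f x).eval t ∂μ := by
  let s := Finset.range (n + 1)
  have hinj : Set.InjOn (fun i : ℕ => (i : ℝ)) s := Nat.cast_injective.injOn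
  refine ⟨Lagrange.interpolate s (fun i : ℕ => (i : ℝ)) fun i => ∫ x, (f x).eval (i : ℝ) ∂μ,
    fun t => ?_⟩
  have h : ∀ x, (f x).eval t =
      ∑ i ∈ s, (f x).eval (i : ℝ) * (Lagrange.basis s (fun i : ℕ => (i : ℝ)) i).eval t := by
    intro x
    have hdeg : (f x).degree < s.card := by
      rw [Finset.card_range]
      exact lt_of_le_of_lt degree_le_natDegree (by exact_mod_cast Nat.lt_succ_of_le (hn x))
    conv_lhs => rw [Lagrange.eq_interpolate hinj hdeg]
    simp [Lagrange.interpolate_apply, eval_finsetSum]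
  rw [funext h]
  rw [MeasureTheory.integral_finsetSum s fun i _ => (hf i).mul_const _]
  simp [Lagrange.interpolate_apply, eval_finsetSum, MeasureTheory.integral_mul_const]

open Polynomial in
theorem not_eval_eq_sqrt_one_add_sq_pow {n : ℕ} (hn : Odd n) (P : ℝ[X]) {δ : ℝ} (hδ : 0 < δ) :
    ¬ ∀ t ∈ Set.Ioo 0 δ, P.eval t = √(1 + t ^ 2) ^ n := by
  intro h
  obtain ⟨m, rfl⟩ := hn
  have hsq : P ^ 2 = (1 + X ^ 2) ^ (2 * m + 1) := by
    refine Polynomial.eq_of_infinite_eval_eq _ _ ((Set.Ioo_infinite hδ).mono fun t ht => ?_)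
    simp only [Set.mem_ofPred_eq, eval_pow, h t ht, eval_add, eval_one, eval_X]
    rw [← pow_mul, mul_comm, pow_mul, Real.sq_sqrt (by positivity)]
  have hdvd : (1 + X ^ 2 : ℝ[X]) ^ m ∣ P := by
    rw [← UniqueFactorizationMonoid.pow_dvd_pow_iff_dvd two_ne_zero, hsq, ← pow_mul]
    exact pow_dvd_pow _ (by lia)
  obtain ⟨R, rfl⟩ := hdvd
  have hne : (1 + X ^ 2 : ℝ[X]) ≠ 0 := fun h0 => by
    simpa using congrArg (eval 0) h0
  have hR : R ^ 2 = 1 + X ^ 2 := by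
    have h2 : ((1 + X ^ 2 : ℝ[X]) ^ m) ^ 2 ≠ 0 := pow_ne_zero _ (pow_ne_zero _ hne)
    refine mul_left_cancel₀ h2 ?_
    rw [← mul_pow, hsq]; ring
  have hdeg : R.natDegree ≤ 1 := by
    have := congrArg natDegree hR
    rw [natDegree_pow] at this
    have h3 : (1 + X ^ 2 : ℝ[X]).natDegree ≤ 2 := by compute_degree
    lia
  rw [Polynomial.eq_X_add_C_of_natDegree_le_one hdeg] at hR
  set a := R.coeff 1
  set b := R.coeff 0
  have e0 : b ^ 2 = 1 := by simpa using! congrArg (eval 0) hR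
  have e1 : (a + b) ^ 2 = 1 + 1 := by simpa using congrArg (eval 1) hR
  have e2 : (-a + b) ^ 2 = 1 + 1 := by simpa using congrArg (eval (-1)) hR
  have hab : a * b = 0 := by linarith
  rcases mul_eq_zero.1 hab with h0 | h0
  · rw [h0] at e1
    nlinarith
  · rw [h0] at e0
    norm_num at e0

theorem image_ball_add_smul_eq {E : Type*} [NormedAddCommGroup E] [InnerProductSpace ℝ E]
    {V : E → E} (hperp : ∀ x, inner ℝ x (V x) = 0) (hone : ∀ x, ‖x‖ = 1 → ‖V x‖ = 1)
    (hle : ∀ x, ‖V x‖ ≤ 1) {t : ℝ} (e : E ≃ₜ E) (he : ∀ x, e x = x + t • V x) :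
    e '' Metric.ball 0 1 = Metric.ball 0 √(1 + t ^ 2) := by
  have hnorm : ∀ x, ‖e x‖ ^ 2 = ‖x‖ ^ 2 + t ^ 2 * ‖V x‖ ^ 2 := by
    intro x
    rw [he, norm_add_sq_real, inner_smul_right, hperp, norm_smul, mul_pow, Real.norm_eq_abs, sq_abs]
    ring
  have hpos : (0 : ℝ) < 1 + t ^ 2 := by positivity
  have hsub : e '' Metric.ball 0 1 ⊆ Metric.ball 0 √(1 + t ^ 2) := by
    rintro _ ⟨x, hx, rfl⟩
    rw [mem_ball_zero_iff] at hx ⊢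
    refine Real.lt_sqrt_of_sq_lt ?_
    rw [hnorm]
    have h1 := hle x
    have : ‖V x‖ ^ 2 ≤ 1 := by nlinarith [norm_nonneg (V x)]
    have : ‖x‖ ^ 2 < 1 := by nlinarith [norm_nonneg x]
    nlinarith [sq_nonneg t]
  have hclosed : Metric.ball 0 √(1 + t ^ 2) ∩ e '' Metric.closedBall 0 1 ⊆ e '' Metric.ball 0 1 := by
    rintro _ ⟨hy, x, hx, rfl⟩
    refine ⟨x, ?_, rfl⟩
    rw [mem_closedBall_zero_iff] at hx
    rw [mem_ball_zero_iff] at hy ⊢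
    refine lt_of_le_of_ne hx fun h1 => ?_
    have := (Real.lt_sqrt (norm_nonneg _)).1 hy
    rw [hnorm, h1, hone x h1] at this
    linarith
  refine hsub.antisymm ?_
  have hconn : IsPreconnected (Metric.ball (0 : E) √(1 + t ^ 2)) := (convex_ball _ _).isPreconnected
  refine fun y hy => ?_
  by_contra hny
  obtain ⟨z, hz, hz1, hz2⟩ := hconn (e '' Metric.ball 0 1) (e '' Metric.closedBall 0 1)ᶜ
    (e.isOpenMap _ Metric.isOpen_ball) (e.isClosedMap _ Metric.isClosed_closedBall).isOpen_compl
    (fun z hz => by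
      by_cases h : z ∈ e '' Metric.closedBall 0 1
      · exact Or.inl (hclosed ⟨hz, h⟩)
      · exact Or.inr h)
    ⟨e 0, hsub ⟨0, by simp, rfl⟩, ⟨0, by simp, rfl⟩⟩
    ⟨y, hy, fun h => hny (hclosed ⟨hy, h⟩)⟩
  exact hz2 (Set.image_mono Metric.ball_subset_closedBall hz1)

theorem not_exists_tangent_field_of_odd_finrank {E : Type*} [NormedAddCommGroup E]
    [InnerProductSpace ℝ E] [FiniteDimensional ℝ E] (hE : Odd (Module.finrank ℝ E))
    {V : E → E} (hV : ContDiff ℝ 1 V) (hsupp : HasCompactSupport V)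
    (hperp : ∀ x, inner ℝ x (V x) = 0) (hone : ∀ x, ‖x‖ = 1 → ‖V x‖ = 1)
    (hle : ∀ x, ‖V x‖ ≤ 1) : False := by
  borelize E
  have : Nontrivial E := Module.nontrivial_of_finrank_pos (R := ℝ) hE.pos
  obtain ⟨K, hK⟩ := hV.lipschitzWith_of_hasCompactSupport hsupp one_ne_zero
  set μ : MeasureTheory.Measure E := MeasureTheory.volume
  choose P hPdeg hPeval using fun x => exists_polynomial_eval_eq_det_one_add_smul (fderiv ℝ V x)
  have hint : ∀ t, MeasureTheory.Integrable (fun x => (P x).eval t)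
      (μ.restrict (Metric.ball 0 1)) := by
    intro t
    simp_rw [hPeval]
    have hc : Continuous fun x => (ContinuousLinearMap.id ℝ E + t • fderiv ℝ V x).det :=
      ContinuousLinearMap.continuous_det.comp
        (continuous_const.add ((hV.continuous_fderiv one_ne_zero).const_smul t))
    exact (hc.continuousOn.integrableOn_compact (isCompact_closedBall 0 1)).mono_set
      Metric.ball_subset_closedBall
  obtain ⟨R, hR⟩ := exists_polynomial_eval_eq_integral P _ hPdeg hint
  have hδ : (0 : ℝ) < 1 / (K + 1) := by positivity
  have hvol : 0 < μ.real (Metric.ball 0 1) :=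
    ENNReal.toReal_pos (Metric.measure_ball_pos _ _ one_pos).ne' MeasureTheory.measure_ball_lt_top.ne
  refine not_eval_eq_sqrt_one_add_sq_pow hE (Polynomial.C (μ.real (Metric.ball 0 1))⁻¹ * R) hδ
    fun t ht => ?_
  have htK : t * K < 1 := by
    have h := (lt_div_iff₀ (by positivity)).1 ht.2
    nlinarith [ht.1]
  obtain ⟨c, hct⟩ : ∃ c : NNReal, (c : ℝ) = t := ⟨⟨t, ht.1.le⟩, rfl⟩
  have hlip : LipschitzOnWith (c * K) (fun x => t • V x) Set.univ := by
    rw [lipschitzOnWith_univ]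
    refine LipschitzWith.of_dist_le_mul fun x y => ?_
    rw [dist_smul₀, Real.norm_of_nonneg ht.1.le, NNReal.coe_mul, hct, mul_assoc]
    exact mul_le_mul_of_nonneg_left (hK.dist_le_mul x y) ht.1.le
  have happ : ApproximatesLinearOn (fun x => x + t • V x)
      ((ContinuousLinearEquiv.refl ℝ E : E ≃L[ℝ] E) : E →L[ℝ] E) Set.univ (c * K) := by
    rw [ApproximatesLinearOn.approximatesLinearOn_iff_lipschitzOnWith]
    convert! hlip using 1
    ext x
    simp
  have hc : Subsingleton E ∨ (c * K : NNReal) <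
      ‖((ContinuousLinearEquiv.refl ℝ E).symm : E →L[ℝ] E)‖₊⁻¹ := by
    right
    have : ‖((ContinuousLinearEquiv.refl ℝ E).symm : E →L[ℝ] E)‖₊ = 1 := by
      simp
    rw [this, inv_one, ← NNReal.coe_lt_coe, NNReal.coe_mul, hct]
    exact htK
  let e := happ.toHomeomorph _ hc
  have he : ∀ x, e x = x + t • V x := fun _ => rfl
  have hder : ∀ x ∈ Metric.ball (0 : E) 1, HasFDerivWithinAt e
      (ContinuousLinearMap.id ℝ E + t • fderiv ℝ V x) (Metric.ball 0 1) x := fun x _ =>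
    ((hasFDerivAt_id x).add (((hV.differentiable one_ne_zero) x).hasFDerivAt.const_smul
      t)).hasFDerivWithinAt
  have hchange := MeasureTheory.integral_image_eq_integral_abs_det_fderiv_smul μ
    measurableSet_ball hder e.injective.injOn fun _ => (1 : ℝ)
  rw [image_ball_add_smul_eq hperp hone hle e he] at hchange
  have hdet : ∀ x, |(ContinuousLinearMap.id ℝ E + t • fderiv ℝ V x).det| = (P x).eval t := by
    intro x
    rw [hPeval, abs_of_pos]
    refine det_id_add_pos _ ?_
    rw [norm_smul, Real.norm_of_nonneg ht.1.le]
    exact (mul_le_mul_of_nonneg_left (norm_fderiv_le_of_lipschitz ℝ hK) ht.1.le).trans_lt htK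
  simp only [hdet, smul_eq_mul, mul_one, ← hR, MeasureTheory.integral_const,
    MeasureTheory.measureReal_restrict_apply_univ] at hchange
  rw [Polynomial.eval_mul, Polynomial.eval_C, ← hchange, MeasureTheory.measureReal_def,
    MeasureTheory.measureReal_def,
    MeasureTheory.Measure.addHaar_ball μ 0 (Real.sqrt_nonneg _), ENNReal.toReal_mul,
    ENNReal.toReal_ofReal (by positivity), mul_comm, mul_assoc, ← MeasureTheory.measureReal_def,
    mul_inv_cancel₀ hvol.ne', mul_one]

theorem exists_eq_smul_self_of_odd_finrank {E : Type*} [NormedAddCommGroup E]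
    [InnerProductSpace ℝ E] [FiniteDimensional ℝ E] (hE : Odd (Module.finrank ℝ E))
    {b : E → E} (hb : ContDiff ℝ 1 b) (R : ℝ) : ∃ v, R ≤ ‖v‖ ∧ ∃ c : ℝ, b v = c • v := by
  by_contra! hR
  set R' := max R 1
  have hR' : 0 < R' := lt_max_of_lt_right one_pos
  let τ : E → E := fun x => ‖x‖ ^ 2 • b ((2 * R') • x) - inner ℝ x (b ((2 * R') • x)) • x
  have hτ : ContDiff ℝ 1 τ := by
    have h : ContDiff ℝ 1 fun x => b ((2 * R') • x) := hb.comp (contDiff_const.smul contDiff_id)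
    exact ((contDiff_norm_sq ℝ).smul h).sub ((contDiff_id.inner ℝ h).smul contDiff_id)
  have hτ0 : ∀ x, 1 / 2 ≤ ‖x‖ → τ x ≠ 0 := by
    intro x hx h0
    have hx0 : 0 < ‖x‖ := by linarith
    refine hR ((2 * R') • x) ?_ ((‖x‖ ^ 2)⁻¹ * inner ℝ x (b ((2 * R') • x)) * (2 * R')⁻¹) ?_
    · rw [norm_smul, Real.norm_of_nonneg (by positivity)]
      calc R ≤ R' := le_max_left _ _
        _ ≤ 2 * R' * ‖x‖ := by nlinarith
    · have h1 := sub_eq_zero.1 h0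
      rw [smul_smul, mul_assoc _ (2 * R')⁻¹, inv_mul_cancel₀ (by positivity), mul_one,
        mul_smul (‖x‖ ^ 2)⁻¹, ← h1, smul_smul, inv_mul_cancel₀ (by positivity), one_smul]
  have hperp : ∀ x, inner ℝ x (τ x) = 0 := by
    intro x
    simp only [τ, inner_sub_right, inner_smul_right, real_inner_self_eq_norm_sq]
    ring
  let f : ContDiffBump (1 : ℝ) := ⟨1 / 4, 1 / 2, by norm_num, by norm_num⟩
  have hf0 : ∀ s, 1 / 2 ≤ |s - 1| → f s = 0 := fun s hs => f.zero_of_le_dist hs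
  let V : E → E := fun x => (f (‖x‖ ^ 2) * ‖τ x‖⁻¹) • τ x
  have hVnorm : ∀ x, ‖V x‖ = f (‖x‖ ^ 2) * (‖τ x‖⁻¹ * ‖τ x‖) := fun x => by
    rw [norm_smul, Real.norm_of_nonneg (mul_nonneg f.nonneg (by positivity)), mul_assoc]
  refine not_exists_tangent_field_of_odd_finrank hE (V := V) ?_ ?_ ?_ ?_ ?_
  · rw [contDiff_iff_contDiffAt]
    intro x
    rcases lt_or_ge ‖x‖ (1 / 2) with hx | hx
    · refine (contDiffAt_const (c := (0 : E))).congr_of_eventuallyEq ?_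
      filter_upwards [continuous_norm.continuousAt.eventually_lt continuousAt_const hx] with y hy
      have : f (‖y‖ ^ 2) = 0 := hf0 _ (by
        rw [abs_of_neg] <;> nlinarith [norm_nonneg y])
      simp [V, this]
    · have h1 : ContDiffAt ℝ 1 (fun x => f (‖x‖ ^ 2)) x :=
        (f.contDiff.comp (contDiff_norm_sq ℝ)).contDiffAt
      have h2 := (hτ.contDiffAt (x := x)).norm ℝ (hτ0 x hx)
      exact (h1.mul (h2.inv (norm_ne_zero_iff.2 (hτ0 x hx)))).smul hτ.contDiffAt
  · refine HasCompactSupport.intro (isCompact_closedBall (0 : E) 2) fun x hx => ?_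
    rw [mem_closedBall_zero_iff, not_le] at hx
    have : f (‖x‖ ^ 2) = 0 := hf0 _ (by rw [abs_of_pos] <;> nlinarith)
    simp [V, this]
  · intro x
    rw [inner_smul_right, hperp, mul_zero]
  · intro x hx
    rw [hVnorm, inv_mul_cancel₀ (norm_ne_zero_iff.2 (hτ0 x (by linarith))), hx, one_pow, mul_one]
    exact f.one_of_mem_closedBall (by simp [f.rIn_pos.le])
  · intro x
    rw [hVnorm]
    exact mul_le_one₀ f.le_one (by positivity) (inv_mul_le_one (a := ‖τ x‖))

theorem Set.Finite.exists_norm_apply_le {W Γ : Type*} [NormedAddCommGroup W] [NormedSpace ℝ W]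
    [FiniteDimensional ℝ W] (ρ : Γ → (W →ₗ[ℝ] W)) {S : Set Γ} (hS : S.Finite) :
    ∃ C : ℝ, 1 ≤ C ∧ ∀ γ ∈ S, ∀ x, ‖ρ γ x‖ ≤ C * ‖x‖ := by
  obtain ⟨C, hC⟩ := (hS.image fun γ => ‖LinearMap.toContinuousLinearMap (ρ γ)‖).bddAbove
  refine ⟨max C 1, le_max_right _ _, fun γ hγ x => ?_⟩
  have h1 : ‖LinearMap.toContinuousLinearMap (ρ γ)‖ ≤ max C 1 :=
    (hC ⟨γ, hγ, rfl⟩).trans (le_max_left _ _)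
  exact ((LinearMap.toContinuousLinearMap (ρ γ)).le_opNorm x).trans
    (mul_le_mul_of_nonneg_right h1 (norm_nonneg x))

open scoped Manifold in
theorem not_proper_and_cocompact_of_odd_finrank {E F Γ : Type*} [NormedAddCommGroup E]
    [InnerProductSpace ℝ E] [FiniteDimensional ℝ E] [NormedAddCommGroup F]
    [InnerProductSpace ℝ F] [FiniteDimensional ℝ F] [Group Γ]
    (hE : Odd (Module.finrank ℝ E)) {w w' : F} (hw : ‖w‖ = 1) (hw' : ‖w'‖ = 1)
    (hww' : inner ℝ w' w = 0) (ρ : Γ →* Module.End ℝ (E × F))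
    (hρ : ∀ γ x, ‖(ρ γ x).1‖ ^ 2 - ‖(ρ γ x).2‖ ^ 2 = ‖x.1‖ ^ 2 - ‖x.2‖ ^ 2)
    (hproper : ∀ M : ℝ, {γ | ∃ x : E × F, ‖x.1‖ ^ 2 - ‖x.2‖ ^ 2 = -1 ∧ ‖x‖ ≤ M ∧
      ‖ρ γ x‖ ≤ M}.Finite)
    {r : ℝ} (hr : ∀ x : E × F, ‖x.1‖ ^ 2 - ‖x.2‖ ^ 2 = -1 → ∃ γ, ‖ρ γ x‖ < r) : False := by
  have hinv : ∀ γ x, ρ γ⁻¹ (ρ γ x) = x := fun γ x => by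
    rw [← Module.End.mul_apply, ← map_mul, inv_mul_cancel, map_one, Module.End.one_apply]
  obtain ⟨C, hC1, hC⟩ := (hproper r).exists_norm_apply_le fun γ => ρ γ
  let z : E → E × F := fun v => (v, √(1 + ‖v‖ ^ 2) • w)
  have hznorm : ∀ v, ‖(z v).2‖ = √(1 + ‖v‖ ^ 2) := fun v => by
    rw [norm_smul, hw, mul_one, Real.norm_of_nonneg (Real.sqrt_nonneg _)]
  have hz : ∀ v, ‖(z v).1‖ ^ 2 - ‖(z v).2‖ ^ 2 = -1 := fun v => by
    rw [hznorm, Real.sq_sqrt (by positivity)]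
    simp [z]
  have hzcont : Continuous z := by fun_prop
  let T : E → Set E := fun v => {b | ∀ γ, ‖ρ γ (z v)‖ ≤ r → ‖ρ γ (b, w')‖ ≤ C}
  have hT : ∀ v, Convex ℝ (T v) := by
    intro v b₁ h₁ b₂ h₂ s t hs ht hst γ hγ
    have hcomb : ((s • b₁ + t • b₂, w') : E × F) = s • (b₁, w') + t • (b₂, w') := by
      ext1
      · simp
      · simp [← add_smul, hst]
    rw [hcomb, map_add, map_smul, map_smul]
    calc _ ≤ ‖s • ρ γ (b₁, w')‖ + ‖t • ρ γ (b₂, w')‖ := norm_add_le _ _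
      _ = s * ‖ρ γ (b₁, w')‖ + t * ‖ρ γ (b₂, w')‖ := by
        rw [norm_smul, norm_smul, Real.norm_of_nonneg hs, Real.norm_of_nonneg ht]
      _ ≤ s * C + t * C := by gcongr; exacts [h₁ γ hγ, h₂ γ hγ]
      _ = C := by rw [← add_mul, hst, one_mul]
  have hTloc : ∀ v₀, ∃ b, ∀ᶠ v in nhds v₀, b ∈ T v := by
    intro v₀
    obtain ⟨γ₀, hγ₀⟩ := hr (z v₀) (hz v₀)
    let A : E →ₗ[ℝ] E := LinearMap.fst ℝ E F ∘ₗ ρ γ₀ ∘ₗ LinearMap.inl ℝ E F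
    have hA : Function.Surjective A := by
      rw [← LinearMap.injective_iff_surjective, injective_iff_map_eq_zero]
      intro b hb
      have h := hρ γ₀ (b, 0)
      have hb' : (ρ γ₀ (b, 0)).1 = 0 := hb
      rw [hb', norm_zero, norm_zero] at h
      have : ‖b‖ ^ 2 = 0 := by nlinarith [sq_nonneg ‖b‖, sq_nonneg ‖(ρ γ₀ (b, 0)).2‖]
      simpa using this
    obtain ⟨b, hb⟩ := hA (-(ρ γ₀ (0, w')).1)
    have hb1 : (ρ γ₀ (b, w')).1 = 0 := by
      have : ((b, w') : E × F) = (b, 0) + (0, w') := by simp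
      rw [this, map_add, Prod.fst_add]
      exact eq_neg_iff_add_eq_zero.1 hb
    have hb2 : ‖ρ γ₀ (b, w')‖ ≤ 1 := by
      have h := hρ γ₀ (b, w')
      rw [hb1, norm_zero, hw'] at h
      rw [Prod.norm_def, hb1, norm_zero]
      refine max_le zero_le_one ?_
      nlinarith [norm_nonneg b, norm_nonneg (ρ γ₀ (b, w')).2]
    have hcont : Continuous fun v => ‖ρ γ₀ (z v)‖ :=
      ((ρ γ₀).continuous_of_finiteDimensional.comp hzcont).norm
    refine ⟨b, ?_⟩
    filter_upwards [hcont.continuousAt.eventually_lt continuousAt_const hγ₀] with v hv γ hγ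
    have hsplit : ∀ x, ρ (γ * γ₀⁻¹) (ρ γ₀ x) = ρ γ x := fun x => by
      rw [map_mul, Module.End.mul_apply, hinv]
    have hmem := hC (γ * γ₀⁻¹) ⟨ρ γ₀ (z v), by rw [hρ, hz], hv.le, by rwa [hsplit]⟩
      (ρ γ₀ (b, w'))
    rw [hsplit] at hmem
    exact hmem.trans (mul_le_of_le_one_right (by linarith) hb2)
  obtain ⟨b, hb⟩ := exists_contMDiffMap_forall_mem_convex_of_local_const 𝓘(ℝ, E) (n := 1) hT hTloc
  obtain ⟨C', hC'1, hC'⟩ := (hproper (C + r)).exists_norm_apply_le fun γ => ρ γ⁻¹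
  obtain ⟨v, hv, c, hc⟩ := exists_eq_smul_self_of_odd_finrank hE b.contMDiff.contDiff (C' * r + 1)
  obtain ⟨γ, hγ⟩ := hr (z v) (hz v)
  have hr0 : 0 < r := (norm_nonneg _).trans_lt hγ
  set k := √(1 + ‖v‖ ^ 2)
  have hk : 1 ≤ k := Real.one_le_sqrt.2 (by nlinarith [sq_nonneg ‖v‖])
  set s : F := w' - (c * k) • w
  have hs : ‖s‖ ^ 2 = 1 + (c * k) ^ 2 := by
    rw [norm_sub_sq_real, inner_smul_right, hww', norm_smul, hw, hw', mul_one, Real.norm_eq_abs,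
      sq_abs]
    ring
  have hs1 : 1 ≤ ‖s‖ := by nlinarith [sq_nonneg (c * k), norm_nonneg s]
  have hsc : |c| ≤ ‖s‖ := by
    refine abs_le_of_sq_le_sq ?_ (norm_nonneg s)
    rw [hs]
    nlinarith [mul_nonneg (sq_nonneg c) (by nlinarith : (0 : ℝ) ≤ k ^ 2 - 1)]
  have hs0 : 0 < ‖s‖ := by linarith
  have hsbound : ‖ρ γ (0, s)‖ ≤ C + |c| * r := by
    have hdecomp : ((0, s) : E × F) = (b v, w') - c • z v := by
      ext1
      · simp [z, hc]
      · simp [z, s, k, smul_smul]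
    rw [hdecomp, map_sub, map_smul]
    refine (norm_sub_le _ _).trans (add_le_add (hb v γ hγ.le) ?_)
    rw [norm_smul, Real.norm_eq_abs]
    gcongr
  have hγmem := hC' γ ⟨(0, ‖s‖⁻¹ • s), ?_, ?_, ?_⟩ (ρ γ (z v))
  · rw [hinv] at hγmem
    have h1 : ‖v‖ ≤ ‖z v‖ := norm_fst_le (z v)
    nlinarith
  · simp [norm_smul, hs0.ne']
  · have : ‖((0, ‖s‖⁻¹ • s) : E × F)‖ = 1 := by simp [Prod.norm_def, norm_smul, hs0.ne']
    linarith
  · have : ((0, ‖s‖⁻¹ • s) : E × F) = ‖s‖⁻¹ • (0, s) := by simp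
    rw [this, map_smul, norm_smul, norm_inv, norm_norm, inv_mul_le_iff₀ hs0]
    nlinarith

/-- `ℝ^p × ℝ^(q+1)`, with Euclidean norms on the factors, identified with `ℝ^(p+q+1)`. -/
def splitEquiv (p q : ℕ) : (EuclideanSpace ℝ (Fin p) × EuclideanSpace ℝ (Fin (q + 1))) ≃ₗ[ℝ]
    (Fin (p + q + 1) → ℝ) :=
  ((WithLp.linearEquiv 2 ℝ (Fin p → ℝ)).prodCongr (WithLp.linearEquiv 2 ℝ (Fin (q + 1) → ℝ))).trans
    ((LinearEquiv.sumArrowLequivProdArrow (Fin p) (Fin (q + 1)) ℝ ℝ).symm.trans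
      (LinearEquiv.funCongrLeft ℝ ℝ (finSumFinEquiv (m := p) (n := q + 1)).symm))

theorem Qpq_splitEquiv (p q : ℕ) (x : EuclideanSpace ℝ (Fin p) × EuclideanSpace ℝ (Fin (q + 1))) :
    Qpq p (p + q + 1) (splitEquiv p q x) = ‖x.1‖ ^ 2 - ‖x.2‖ ^ 2 := by
  have h1 : ∀ i, splitEquiv p q x (Fin.castAdd (q + 1) i) = x.1 i := fun i => by
    simp [splitEquiv, LinearEquiv.funCongrLeft_apply, LinearMap.funLeft_apply]
  have h2 : ∀ i, splitEquiv p q x (Fin.natAdd p i) = x.2 i := fun i => by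
    simp [splitEquiv, LinearEquiv.funCongrLeft_apply, LinearMap.funLeft_apply]
  rw [EuclideanSpace.norm_sq_eq, EuclideanSpace.norm_sq_eq, Qpq]
  refine (Fin.sum_univ_add (a := p) (b := q + 1) _).trans ?_
  rw [sub_eq_add_neg, ← Finset.sum_neg_distrib]
  congr 1
  · refine Finset.sum_congr rfl fun i _ => ?_
    rw [h1, if_pos (by simp), Real.norm_eq_abs, sq_abs]
  · refine Finset.sum_congr rfl fun i _ => ?_
    rw [h2, if_neg (by simp), Real.norm_eq_abs, sq_abs]

theorem isCompact_setOf_norm_symm_le {W : Type*} [NormedAddCommGroup W] [NormedSpace ℝ W]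
    [FiniteDimensional ℝ W] {p N : ℕ} (L : W ≃ₗ[ℝ] (Fin N → ℝ)) (M : ℝ) :
    IsCompact {x : Hpq p N | ‖L.symm x.val‖ ≤ M} := by
  have hQ : Continuous (Qpq p N) := by
    unfold Qpq
    refine continuous_finsetSum _ fun i _ => ?_
    split_ifs <;> fun_prop
  have hcl : Topology.IsClosedEmbedding (fun x : Hpq p N => x.val) :=
    (isClosed_eq hQ continuous_const).isClosedEmbedding_subtypeVal
  have hK : IsCompact {y : Fin N → ℝ | ‖L.symm y‖ ≤ M} := by
    have h := L.symm.toContinuousLinearEquiv.toHomeomorph.isCompact_preimage.2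
      (isCompact_closedBall (0 : W) M)
    convert h using 1
    ext y
    simp
  exact hcl.isCompact_preimage hK

instance (p N : ℕ) : ContinuousConstSMul ↥(Opq p N) (Hpq p N) where
  continuous_const_smul _ := Continuous.subtype_mk
    (continuous_const.matrix_mulVec continuous_subtype_val) _

theorem exists_norm_symm_smul_lt {W : Type*} [NormedAddCommGroup W] [NormedSpace ℝ W]
    [FiniteDimensional ℝ W] {p N : ℕ} (L : W ≃ₗ[ℝ] (Fin N → ℝ)) (Γ : Subgroup ↥(Opq p N))
    [CompactSpace (MulAction.orbitRel.Quotient ↥Γ (Hpq p N))] :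
    ∃ r : ℝ, ∀ x : Hpq p N, ∃ γ : Γ, ‖L.symm (γ • x).val‖ < r := by
  have : ContinuousConstSMul ↥Γ (Hpq p N) := ⟨fun γ => continuous_const_smul γ.val⟩
  let π : Hpq p N → MulAction.orbitRel.Quotient ↥Γ (Hpq p N) := Quotient.mk _
  have hcont : Continuous fun x : Hpq p N => ‖L.symm x.val‖ :=
    (L.symm.toLinearMap.continuous_of_finiteDimensional.comp continuous_subtype_val).norm
  let U : ℕ → Set (Hpq p N) := fun n => {x | ‖L.symm x.val‖ < n}
  obtain ⟨n, hn⟩ := isCompact_univ.elim_directed_cover (fun n => π '' U n)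
    (fun n => isOpenMap_quotient_mk'_mul _ (isOpen_lt hcont continuous_const))
    (fun y _ => by
      obtain ⟨x, rfl⟩ := Quotient.exists_rep y
      obtain ⟨n, hn⟩ := exists_nat_gt ‖L.symm x.val‖
      exact Set.mem_iUnion.2 ⟨n, x, hn, rfl⟩)
    (Monotone.directed_le fun m n hmn => Set.image_mono fun x hx =>
      show ‖L.symm x.val‖ < n from lt_of_lt_of_le hx (Nat.cast_le.2 hmn))
  refine ⟨n, fun x => ?_⟩
  obtain ⟨y, hy, hyx⟩ := hn (Set.mem_univ (π x))
  obtain ⟨γ, rfl⟩ := MulAction.orbitRel_apply.1 (Quotient.exact hyx)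
  exact ⟨γ, hy⟩

/-- The linear representation of `O(p, N - p)` on a space identified with `ℝ^N`. -/
def Opq.toEnd {W : Type*} [AddCommGroup W] [Module ℝ W] {p N : ℕ} (L : W ≃ₗ[ℝ] (Fin N → ℝ)) :
    ↥(Opq p N) →* Module.End ℝ W where
  toFun A := L.symm.toLinearMap ∘ₗ A.val.val.mulVecLin ∘ₗ L.toLinearMap
  map_one' := by ext; simp
  map_mul' A B := by ext; simp

/-- **No compact Clifford–Klein forms for `H^{p,q}`, `p` odd.**
If `p` is an odd positive integer and `q > 0`, there is no discrete subgroup `Γ` of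
`O(p,q+1)` acting properly discontinuously and cocompactly on the quadric
`H^{p,q} = {Q = -1} ⊂ ℝ^{p+q+1}`. -/
theorem no_compact_CliffordKlein_form_Hpq (p q : ℕ) (hp : 0 < p) (hq : 0 < q)
    (hodd : Odd p) :
    ¬ ∃ Γ : Subgroup ↥(Opq p (p + q + 1)), DiscreteTopology ↥Γ ∧
      ProperlyDiscontinuousSMul ↥Γ (Hpq p (p + q + 1)) ∧
      CompactSpace (MulAction.orbitRel.Quotient ↥Γ (Hpq p (p + q + 1))) := by
  rintro ⟨Γ, -, _, _⟩
  set L := splitEquiv p q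
  obtain ⟨r, hr⟩ := exists_norm_symm_smul_lt L Γ
  let w : Fin (q + 1) → EuclideanSpace ℝ (Fin (q + 1)) := fun i => EuclideanSpace.single i 1
  have hlast : Fin.last q ≠ 0 := fun h => hq.ne' (congrArg Fin.val h)
  have hmem : ∀ x, ‖x.1‖ ^ 2 - ‖x.2‖ ^ 2 = -1 → Qpq p (p + q + 1) (L x) = -1 := fun x hx => by
    rw [Qpq_splitEquiv, hx]
  refine not_proper_and_cocompact_of_odd_finrank (E := EuclideanSpace ℝ (Fin p)) (w := w 0)
    (w' := w (Fin.last q)) (r := r) (by simpa using hodd) (by simp [w]) (by simp [w])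
    (by simp [w, EuclideanSpace.inner_single_left, hlast])
    ((Opq.toEnd L).comp Γ.subtype) (fun γ x => ?_) (fun M => ?_) (fun x hx => ?_)
  · rw [← Qpq_splitEquiv, ← Qpq_splitEquiv]
    refine Eq.trans ?_ (γ.val.prop (L x))
    exact congrArg _ (L.apply_symm_apply _)
  · have hK := isCompact_setOf_norm_symm_le (p := p) L M
    refine (ProperlyDiscontinuousSMul.finite_disjoint_inter_image (Γ := Γ) hK hK).subset ?_
    rintro γ ⟨x, hx, hxM, hγM⟩
    let y : Hpq p (p + q + 1) := ⟨L x, hmem x hx⟩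
    refine ⟨γ • y, ⟨y, ?_, rfl⟩, hγM⟩
    exact (congrArg norm (L.symm_apply_apply x)).trans_le hxM
  · exact hr ⟨L x, hmem x hx⟩
end
end

section
/- Let p, q, r be positive integers with p odd. Let J = diag(I_p, -I_{q+r}) and let G = {A ∈ GL(p+q+r, ℝ) : Aᵀ J A = J and det A = 1} (the indefinite special orthogonal group SO(p,q+r)), and let H = {A ∈ G : A e_i = e_i for every index i with p+q < i ≤ p+q+r}, where e_i denotes the i-th standard basis vector (H is the standard copy of SO(p,q) fixing the last r coordinates). Then there is no discrete subgroup Γ of G acting properly discontinuously and cocompactly on the homogeneous space G/H; that is, SO(p,q+r)/SO(p,q) admits no compact Clifford–Klein form when p is odd. -/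
/-!
The homogeneous space `SO(p,q+r)/SO(p,q)` admits no compact Clifford–Klein form
when `p` is odd.
-/

open Matrix

set_option maxHeartbeats 1000000
set_option synthInstance.maxHeartbeats 1000000

noncomputable section

/-- The diagonal matrix `J = diag(I_p, -I_{N-p})` of signature `(p, N-p)`. -/
def signatureMatrix (p N : ℕ) : Matrix (Fin N) (Fin N) ℝ :=
  Matrix.diagonal (fun i => if (i : ℕ) < p then 1 else -1)

/-- The indefinite special orthogonal group `SO(p, N-p)`, realized as the subgroup of
`GL(N, ℝ)` of matrices `A` with `Aᵀ J A = J` and `det A = 1`, where `J = diag(I_p, -I_{N-p})`. -/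
def indefSO (p N : ℕ) : Subgroup (GL (Fin N) ℝ) where
  carrier := {A | A.valᵀ * signatureMatrix p N * A.val = signatureMatrix p N ∧ A.val.det = 1}
  one_mem' := by constructor <;> simp
  mul_mem' := by
    rintro A B ⟨hA1, hA2⟩ ⟨hB1, hB2⟩
    constructor
    · have key : (A * B).valᵀ * signatureMatrix p N * (A * B).val =
          B.valᵀ * (A.valᵀ * signatureMatrix p N * A.val) * B.val := by
        rw [Units.val_mul, transpose_mul]
        simp only [Matrix.mul_assoc]
      rw [key, hA1]
      exact hB1
    · rw [Units.val_mul, det_mul, hA2, hB2, mul_one]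
  inv_mem' := by
    rintro A ⟨hA1, hA2⟩
    constructor
    · calc (A⁻¹).valᵀ * signatureMatrix p N * (A⁻¹).val
          = (A⁻¹).valᵀ * (A.valᵀ * signatureMatrix p N * A.val) * (A⁻¹).val := by rw [hA1]
        _ = (A.val * (A⁻¹).val)ᵀ * signatureMatrix p N * (A.val * (A⁻¹).val) := by
            rw [transpose_mul]
            simp only [Matrix.mul_assoc]
        _ = signatureMatrix p N := by rw [Units.mul_inv]; simp
    · have h := congrArg Matrix.det (Units.mul_inv A)
      rw [det_mul, hA2, one_mul] at h
      simpa using h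

/-- The standard copy of `SO(p,q)` inside `SO(p,q+r)`: the subgroup of elements fixing the
standard basis vectors `e_i` with `p + q < i ≤ p + q + r` (i.e., in the 0-based indexing of
`Fin (p+q+r)`, those with `p + q ≤ i`). -/
def indefSOsub (p q r : ℕ) : Subgroup ↥(indefSO p (p + q + r)) where
  carrier := {A | ∀ i : Fin (p + q + r), p + q ≤ (i : ℕ) →
      A.val.val *ᵥ Pi.single i 1 = Pi.single i 1}
  one_mem' := by
    intro i _
    show (1 : Matrix (Fin (p + q + r)) (Fin (p + q + r)) ℝ) *ᵥ Pi.single i 1 = Pi.single i 1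
    rw [Matrix.one_mulVec]
  mul_mem' := by
    intro A B hA hB i hi
    have h : (A * B).val.val = A.val.val * B.val.val := rfl
    rw [h, ← Matrix.mulVec_mulVec, hB i hi, hA i hi]
  inv_mem' := by
    intro A hA i hi
    have h1 : (A⁻¹).val.val * A.val.val = 1 := by
      have h : (A⁻¹).val = (A.val)⁻¹ := rfl
      rw [h]
      exact Units.inv_mul A.val
    calc (A⁻¹).val.val *ᵥ Pi.single i 1
        = (A⁻¹).val.val *ᵥ (A.val.val *ᵥ Pi.single i 1) := by rw [hA i hi]
      _ = Pi.single i 1 := by rw [Matrix.mulVec_mulVec, h1, Matrix.one_mulVec]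

lemma Polynomial.sq_ne_C_mul_one_add_X_sq_pow {n : ℕ} (hn : Odd n) {c : ℝ} (hc : 0 < c)
    (P : Polynomial ℝ) (h0 : 0 < P.eval 0) :
    P ^ 2 ≠ Polynomial.C c * (1 + Polynomial.X ^ 2) ^ n := by
  intro h
  have hq : (1 + Polynomial.X ^ 2 : Polynomial ℝ).natDegree = 2 := by compute_degree!
  have hdeg : P.natDegree = n := by
    have := congrArg Polynomial.natDegree h
    rw [Polynomial.natDegree_pow, Polynomial.natDegree_C_mul hc.ne', Polynomial.natDegree_pow,
      hq] at this
    omega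
  have hroot : ∀ y, ¬ P.IsRoot y := by
    intro y hy
    have := congrArg (Polynomial.eval y) h
    simp only [Polynomial.eval_pow, Polynomial.eval_mul, Polynomial.eval_C, Polynomial.eval_add,
      Polynomial.eval_one, Polynomial.eval_X, hy.eq_zero] at this
    have hpos : 0 < c * (1 + y ^ 2) ^ n := by positivity
    rw [zero_pow two_ne_zero] at this
    exact hpos.ne this
  rcases le_total 0 P.leadingCoeff with hl | hl
  · have := Polynomial.zero_lt_negOnePow_mul_eval_of_lt_roots_of_leadingCoeff_nonneg
      (x := 0) (fun y hy => absurd hy (hroot y)) hl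
    rw [hdeg, Int.negOnePow_odd _ (by exact_mod_cast hn)] at this
    push_cast at this
    linarith
  · have := Polynomial.eval_lt_zero_of_roots_lt_of_leadingCoeff_nonpos
      (x := 0) (fun y hy => absurd hy (hroot y)) hl
    linarith

lemma exists_polynomial_eval_eq_det_one_add_smul_s1 {n : Type*} [Fintype n] [DecidableEq n]
    (M : Matrix n n ℝ) :
    ∃ Q : Polynomial ℝ, Q.degree < (Finset.range (Fintype.card n + 1)).card ∧
      ∀ t : ℝ, Q.eval t = (1 + t • M).det := by
  refine ⟨((Polynomial.X : Polynomial ℝ) • M.map Polynomial.C +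
    (1 : Matrix n n ℝ).map Polynomial.C).det, ?_, ?_⟩
  · refine lt_of_le_of_lt Polynomial.degree_le_natDegree ?_
    rw [Finset.card_range]
    exact_mod_cast Nat.lt_succ_of_le (Polynomial.natDegree_det_X_add_C_le M 1)
  · intro t
    rw [← Polynomial.coe_evalRingHom, RingHom.map_det]
    congr 1
    ext i j
    by_cases h : i = j <;> simp [h, add_comm, mul_comm t]

lemma exists_polynomial_eval_eq_integral_det {X n : Type*} [Fintype n] [DecidableEq n]
    [MeasurableSpace X] (μ : MeasureTheory.Measure X) (M : X → Matrix n n ℝ)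
    (hM : ∀ t : ℝ, MeasureTheory.Integrable (fun x => (1 + t • M x).det) μ) :
    ∃ P : Polynomial ℝ, ∀ t : ℝ, P.eval t = ∫ x, (1 + t • M x).det ∂μ := by
  set s := Finset.range (Fintype.card n + 1)
  have hinj : Set.InjOn (fun i : ℕ => (i : ℝ)) s := Nat.cast_injective.injOn
  refine ⟨Lagrange.interpolate s (fun i : ℕ => (i : ℝ))
    (fun i => ∫ x, (1 + (i : ℝ) • M x).det ∂μ), fun t => ?_⟩
  have key : ∀ x, (1 + t • M x).det = ∑ i ∈ s, (1 + (i : ℝ) • M x).det *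
      (Lagrange.basis s (fun i : ℕ => (i : ℝ)) i).eval t := by
    intro x
    obtain ⟨Q, hQd, hQ⟩ := exists_polynomial_eval_eq_det_one_add_smul_s1 (M x)
    rw [← hQ t, Lagrange.eq_interpolate_of_eval_eq (fun i : ℕ => (1 + (i : ℝ) • M x).det) hinj hQd
      (fun i _ => hQ i), Lagrange.interpolate_apply, Polynomial.eval_finsetSum]
    simp
  simp_rw [key]
  rw [MeasureTheory.integral_finsetSum s (fun i _ => (hM (i : ℝ)).mul_const _),
    Lagrange.interpolate_apply, Polynomial.eval_finsetSum]
  simp [MeasureTheory.integral_mul_const]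

lemma det_one_add_pos_of_norm_lt_one {E : Type*} [NormedAddCommGroup E] [NormedSpace ℝ E]
    [FiniteDimensional ℝ E] (L : E →L[ℝ] E) (hL : ‖L‖ < 1) :
    0 < (ContinuousLinearMap.id ℝ E + L).det := by
  have hne : ∀ s ∈ Set.Icc (0 : ℝ) 1, (ContinuousLinearMap.id ℝ E + s • L).det ≠ 0 := by
    intro s hs h0
    obtain ⟨x, hx, hx0⟩ := (Submodule.ne_bot_iff _).1
      (LinearMap.bot_lt_ker_of_det_eq_zero h0).ne'
    have hx' : x + s • L x = 0 := by simpa using hx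
    have h1 : ‖x‖ = s * ‖L x‖ := by
      rw [← Real.norm_of_nonneg hs.1, ← norm_smul, ← norm_neg (s • L x),
        ← eq_neg_of_add_eq_zero_left hx']
    have h2 := L.le_opNorm x
    have h3 : 0 < ‖x‖ := norm_pos_iff.2 hx0
    nlinarith [hs.2, hs.1, norm_nonneg (L x)]
  have hcont : Continuous fun s : ℝ => (ContinuousLinearMap.id ℝ E + s • L).det :=
    ContinuousLinearMap.continuous_det.comp (by fun_prop)
  by_contra hneg
  push Not at hneg
  have h0 : (0 : ℝ) ∈ Set.Icc ((ContinuousLinearMap.id ℝ E + (1 : ℝ) • L).det)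
      ((ContinuousLinearMap.id ℝ E + (0 : ℝ) • L).det) := by
    constructor
    · simpa using hneg
    · simp [ContinuousLinearMap.det]
  obtain ⟨s, hs, hs0⟩ := intermediate_value_Icc' zero_le_one hcont.continuousOn h0
  exact hne s hs hs0

/-- The spherical shell `2R ≤ ‖x‖ ≤ 3R`. -/
def shell (E : Type*) [NormedAddCommGroup E] (R : ℝ) : Set E := {x | 2 * R ≤ ‖x‖ ∧ ‖x‖ ≤ 3 * R}

lemma isCompact_shell (E : Type*) [NormedAddCommGroup E] [ProperSpace E] (R : ℝ) :
    IsCompact (shell E R) :=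
  (isCompact_closedBall (0 : E) (3 * R)).of_isClosed_subset
    ((isClosed_le continuous_const continuous_norm).inter
      (isClosed_le continuous_norm continuous_const))
    fun x hx => by simpa using hx.2

section Milnor

open scoped Pointwise

variable {E : Type*} [NormedAddCommGroup E] [InnerProductSpace ℝ E]

lemma norm_add_smul_sq_of_tangent {u : E → E} (horth : ∀ x, inner ℝ x (u x) = 0) (t : ℝ) (x : E) :
    ‖x + t • u x‖ ^ 2 = ‖x‖ ^ 2 + t ^ 2 * ‖u x‖ ^ 2 := by
  rw [norm_add_sq_real, inner_smul_right, horth, norm_smul, mul_pow, Real.norm_eq_abs, sq_abs]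
  ring

lemma image_shell_of_tangent {u : E → E} {R t : ℝ} (hR : 0 < R) (ht1 : t ≤ 1) (ht0 : 0 ≤ t)
    (horth : ∀ x, inner ℝ x (u x) = 0) (hle : ∀ x, ‖u x‖ ≤ ‖x‖)
    (heq : ∀ x, 2 * R ≤ ‖x‖ → ‖x‖ ≤ 5 * R → ‖u x‖ = ‖x‖)
    (hsurj : Function.Surjective fun x => x + t • u x) :
    (fun x => x + t • u x) '' shell E R = √(1 + t ^ 2) • shell E R := by
  have hs : (√(1 + t ^ 2)) ^ 2 = 1 + t ^ 2 := Real.sq_sqrt (by positivity)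
  have hspos : 0 < √(1 + t ^ 2) := Real.sqrt_pos.2 (by positivity)
  have hnorm : ∀ x, 2 * R ≤ ‖x‖ → ‖x‖ ≤ 5 * R → ‖x + t • u x‖ = √(1 + t ^ 2) * ‖x‖ := by
    intro x h1 h2
    rw [← sq_eq_sq₀ (norm_nonneg _) (by positivity), norm_add_smul_sq_of_tangent horth, heq x h1 h2,
      mul_pow, hs]
    ring
  have hmem : ∀ z : E, z ∈ √(1 + t ^ 2) • shell E R ↔
      √(1 + t ^ 2) * (2 * R) ≤ ‖z‖ ∧ ‖z‖ ≤ √(1 + t ^ 2) * (3 * R) := by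
    intro z
    rw [Set.mem_smul_set_iff_inv_smul_mem₀ hspos.ne']
    simp only [shell, Set.mem_ofPred_eq, norm_smul, norm_inv, Real.norm_of_nonneg hspos.le]
    rw [le_inv_mul_iff₀ hspos, inv_mul_le_iff₀ hspos]
  ext z
  rw [hmem]
  constructor
  · rintro ⟨x, ⟨h1, h2⟩, rfl⟩
    simp only
    rw [hnorm x h1 (by linarith)]
    exact ⟨by gcongr, by gcongr⟩
  · rintro ⟨h1, h2⟩
    obtain ⟨x, rfl⟩ := hsurj z
    simp only at h1 h2
    have hx := norm_add_smul_sq_of_tangent horth t x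
    have hs2 : √(1 + t ^ 2) ≤ 3 / 2 := by nlinarith
    have hu := hle x
    have hu2 : ‖u x‖ ^ 2 ≤ ‖x‖ ^ 2 := by gcongr
    have hA : 2 * R ≤ ‖x‖ := by
      have : ‖x + t • u x‖ ≤ √(1 + t ^ 2) * ‖x‖ := by
        rw [← sq_le_sq₀ (norm_nonneg _) (by positivity), hx, mul_pow, hs]
        nlinarith [sq_nonneg t]
      exact le_of_mul_le_mul_left (h1.trans this) hspos
    have hB : ‖x‖ ≤ 5 * R := by
      have : ‖x‖ ≤ ‖x + t • u x‖ := by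
        rw [← sq_le_sq₀ (norm_nonneg _) (norm_nonneg _), hx]
        have : 0 ≤ t ^ 2 * ‖u x‖ ^ 2 := by positivity
        linarith
      nlinarith
    rw [hnorm x hA hB] at h2
    exact ⟨x, ⟨hA, le_of_mul_le_mul_left h2 hspos⟩, rfl⟩

lemma bijective_id_add_smul_of_lipschitz [FiniteDimensional ℝ E] {u : E → E} {C : NNReal}
    (hC : LipschitzWith C u) {t : ℝ} (ht0 : 0 ≤ t) (ht : t * C < 1) :
    Function.Bijective fun x => x + t • u x := by
  have happ : ApproximatesLinearOn (fun x => x + t • u x)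
      ((ContinuousLinearEquiv.refl ℝ E : E ≃L[ℝ] E) : E →L[ℝ] E) Set.univ
      (t.toNNReal * C : NNReal) := by
    intro x _ y _
    have h := hC.dist_le_mul x y
    rw [dist_eq_norm, dist_eq_norm] at h
    have e : x + t • u x - (y + t • u y) -
        ((ContinuousLinearEquiv.refl ℝ E : E ≃L[ℝ] E) : E →L[ℝ] E) (x - y)
        = t • (u x - u y) := by
      simp [smul_sub]; abel
    rw [e, norm_smul, Real.norm_of_nonneg ht0]
    calc t * ‖u x - u y‖ ≤ t * (C * ‖x - y‖) := by gcongr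
      _ = _ := by rw [NNReal.coe_mul, Real.coe_toNNReal _ ht0, mul_assoc]
  have hcase : Subsingleton E ∨ (t.toNNReal * C : NNReal) <
      ‖(((ContinuousLinearEquiv.refl ℝ E : E ≃L[ℝ] E).symm : E ≃L[ℝ] E) : E →L[ℝ] E)‖₊⁻¹ := by
    rcases subsingleton_or_nontrivial E with h | h
    · exact Or.inl h
    · right
      have :
          ‖(((ContinuousLinearEquiv.refl ℝ E : E ≃L[ℝ] E).symm : E ≃L[ℝ] E) : E →L[ℝ] E)‖₊ = 1 := by
        ext
        simp
      rw [this, inv_one, ← NNReal.coe_lt_coe, NNReal.coe_mul, Real.coe_toNNReal _ ht0]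
      exact ht
  have : CompleteSpace E := FiniteDimensional.complete ℝ E
  exact (happ.toHomeomorph _ hcase).bijective

lemma false_of_compactly_supported_tangent_field [FiniteDimensional ℝ E]
    (hp : Odd (Module.finrank ℝ E)) {u : E → E} {R : ℝ} (hR : 0 < R)
    (hu : ContDiff ℝ 1 u) (hsupp : HasCompactSupport u)
    (horth : ∀ x, inner ℝ x (u x) = 0) (hle : ∀ x, ‖u x‖ ≤ ‖x‖)
    (heq : ∀ x, 2 * R ≤ ‖x‖ → ‖x‖ ≤ 5 * R → ‖u x‖ = ‖x‖) : False := by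
  borelize E
  obtain ⟨C, hC⟩ := hu.lipschitzWith_of_hasCompactSupport hsupp one_ne_zero
  set μ := (MeasureTheory.volume : MeasureTheory.Measure E).restrict (shell E R)
  set b := Module.finBasis ℝ E
  set M : E → Matrix (Fin (Module.finrank ℝ E)) (Fin (Module.finrank ℝ E)) ℝ :=
    fun x => LinearMap.toMatrix b b (fderiv ℝ u x)
  have hdet : ∀ (t : ℝ) (x : E), (1 + t • M x).det =
      (ContinuousLinearMap.id ℝ E + t • fderiv ℝ u x).det := by
    intro t x
    rw [ContinuousLinearMap.det, ← LinearMap.det_toMatrix b]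
    congr 1
    rw [ContinuousLinearMap.toLinearMap_add, ContinuousLinearMap.toLinearMap_smul, map_add,
      map_smul, ContinuousLinearMap.coe_id, LinearMap.toMatrix_id]
  have hcont : ∀ t : ℝ, Continuous fun x => (1 + t • M x).det := by
    intro t
    simp_rw [hdet]
    have := hu.continuous_fderiv one_ne_zero
    exact ContinuousLinearMap.continuous_det.comp (by fun_prop)
  obtain ⟨P, hP⟩ := exists_polynomial_eval_eq_integral_det μ M
    (fun t => ((hcont t).continuousOn.integrableOn_compact (isCompact_shell E R)))
  set c := MeasureTheory.volume.real (shell E R)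
  have : Nontrivial E := Module.nontrivial_of_finrank_pos hp.pos
  have hc : 0 < c := by
    refine ENNReal.toReal_pos ?_ (isCompact_shell E R).measure_lt_top.ne
    have hopen : IsOpen {x : E | 2 * R < ‖x‖ ∧ ‖x‖ < 3 * R} :=
      (isOpen_lt continuous_const continuous_norm).inter
        (isOpen_lt continuous_norm continuous_const)
    have hne : {x : E | 2 * R < ‖x‖ ∧ ‖x‖ < 3 * R}.Nonempty := by
      obtain ⟨x, hx⟩ := exists_norm_eq E (show (0 : ℝ) ≤ 5 / 2 * R by positivity)
      exact ⟨x, by simp only [Set.mem_ofPred_eq, hx]; constructor <;> linarith⟩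
    exact ((hopen.measure_pos MeasureTheory.volume hne).trans_le
      (MeasureTheory.measure_mono (t := shell E R) fun x hx => ⟨hx.1.le, hx.2.le⟩)).ne'
  have hfd : ∀ x, ‖fderiv ℝ u x‖ ≤ C := fun x => norm_fderiv_le_of_lipschitz ℝ hC
  have hval : ∀ t : ℝ, 0 ≤ t → t ≤ 1 → t * C < 1 →
      P.eval t = √(1 + t ^ 2) ^ Module.finrank ℝ E * c := by
    intro t ht0 ht1 ht
    have hbij := bijective_id_add_smul_of_lipschitz hC ht0 ht
    have himg := image_shell_of_tangent hR ht1 ht0 horth hle heq hbij.2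
    have hder : ∀ x ∈ shell E R, HasFDerivWithinAt (fun x => x + t • u x)
        (ContinuousLinearMap.id ℝ E + t • fderiv ℝ u x) (shell E R) x := fun x _ =>
      ((hasFDerivAt_id x).add
        (((hu.differentiable one_ne_zero x).hasFDerivAt).const_smul t)).hasFDerivWithinAt
    have hcov := MeasureTheory.integral_image_eq_integral_abs_det_fderiv_smul
      MeasureTheory.volume (isCompact_shell E R).measurableSet hder (hbij.1.injOn)
      (fun _ => (1 : ℝ))
    rw [himg] at hcov
    simp only [smul_eq_mul, mul_one, MeasureTheory.integral_const, MeasurableSet.univ,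
      MeasureTheory.measureReal_restrict_apply, Set.univ_inter] at hcov
    rw [hP, ← show MeasureTheory.volume.real (√(1 + t ^ 2) • shell E R) =
        √(1 + t ^ 2) ^ Module.finrank ℝ E * c by
      rw [MeasureTheory.measureReal_def, MeasureTheory.Measure.addHaar_smul, ENNReal.toReal_mul,
        ENNReal.toReal_ofReal (abs_nonneg _),
        abs_of_nonneg (by positivity)]; rfl, hcov]
    refine MeasureTheory.integral_congr_ae (Filter.Eventually.of_forall fun x => ?_)
    simp only
    rw [hdet, abs_of_pos]
    refine det_one_add_pos_of_norm_lt_one _ ?_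
    rw [norm_smul, Real.norm_of_nonneg ht0]
    exact (mul_le_mul_of_nonneg_left (hfd x) ht0).trans_lt ht
  refine Polynomial.sq_ne_C_mul_one_add_X_sq_pow hp (pow_pos hc 2) P ?_ ?_
  · rw [hval 0 le_rfl zero_le_one (by simp)]
    simpa using hc
  · refine Polynomial.eq_of_infinite_eval_eq _ _
      (Set.Infinite.mono (s := Set.Ioo 0 (1 / (1 + (C : ℝ))))
      ?_ (Set.Ioo_infinite (by positivity)))
    intro t ht
    have h1 : t * (1 + (C : ℝ)) < 1 := by
      have := ht.2
      rwa [lt_div_iff₀ (by positivity)] at this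
    have hC0 : (0 : ℝ) ≤ C := C.2
    have h0 := ht.1
    have hs : (√(1 + t ^ 2)) ^ 2 = 1 + t ^ 2 := Real.sq_sqrt (by positivity)
    simp only [Set.mem_ofPred_eq, Polynomial.eval_pow, Polynomial.eval_mul, Polynomial.eval_C,
      Polynomial.eval_add, Polynomial.eval_one, Polynomial.eval_X]
    rw [hval t h0.le (by nlinarith) (by nlinarith), mul_pow, pow_right_comm, hs]
    ring

/-- A form of the hairy ball theorem: in odd dimension, a vector field is radial at some point
outside any given ball. -/
theorem exists_eq_smul_of_contDiff [FiniteDimensional ℝ E] (hp : Odd (Module.finrank ℝ E))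
    {w : E → E} (hw : ContDiff ℝ 1 w) {R : ℝ} (hR : 0 < R) :
    ∃ x, R ≤ ‖x‖ ∧ ∃ a : ℝ, w x = a • x := by
  by_contra! hne
  set τ : E → E := fun x => ‖x‖ ^ 2 • w x - (inner ℝ x (w x) : ℝ) • x with hτ
  have hτ_smooth : ContDiff ℝ 1 τ :=
    ((contDiff_norm_sq ℝ).smul hw).sub ((contDiff_id.inner ℝ hw).smul contDiff_id)
  have hτ_orth : ∀ x, inner ℝ x (τ x) = 0 := by
    intro x
    simp only [hτ, inner_sub_right, inner_smul_right, real_inner_self_eq_norm_sq]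
    ring
  have hτ_ne : ∀ x, R ≤ ‖x‖ → τ x ≠ 0 := by
    intro x hx h0
    have hx0 : ‖x‖ ^ 2 ≠ 0 := (pow_pos (hR.trans_le hx) 2).ne'
    apply hne x hx ((‖x‖ ^ 2)⁻¹ * (inner ℝ x (w x) : ℝ))
    rw [mul_smul, ← sub_eq_zero.1 h0, smul_smul, inv_mul_cancel₀ hx0, one_smul]
  let χ : ContDiffBump (29 / 2 * R ^ 2 : ℝ) :=
    ⟨21 / 2 * R ^ 2, 13 * R ^ 2, by positivity, by nlinarith [sq_pos_of_pos hR]⟩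
  have hχ_one : ∀ x : E, 2 * R ≤ ‖x‖ → ‖x‖ ≤ 5 * R → χ (‖x‖ ^ 2) = 1 := by
    intro x h1 h2
    refine χ.one_of_mem_closedBall ?_
    rw [Metric.mem_closedBall, Real.dist_eq, abs_le]
    change -(21 / 2 * R ^ 2) ≤ _ ∧ _ ≤ (21 / 2 * R ^ 2)
    constructor <;> nlinarith
  have hχ_zero : ∀ x : E, (‖x‖ ^ 2 < 3 / 2 * R ^ 2 ∨ 28 * R ^ 2 < ‖x‖ ^ 2) → χ (‖x‖ ^ 2) = 0 := by
    intro x h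
    refine χ.zero_of_le_dist ?_
    rw [Real.dist_eq, le_abs]
    change 13 * R ^ 2 ≤ _ ∨ 13 * R ^ 2 ≤ _
    rcases h with h | h
    · right; linarith
    · left; nlinarith
  refine false_of_compactly_supported_tangent_field hp
    (u := fun x => (χ (‖x‖ ^ 2) * (‖x‖ * ‖τ x‖⁻¹)) • τ x) hR ?_ ?_ ?_ ?_ ?_
  · rw [contDiff_iff_contDiffAt]
    intro x
    rcases lt_or_ge (‖x‖ ^ 2) (3 / 2 * R ^ 2) with h | h
    · refine (contDiffAt_const (c := (0 : E))).congr_of_eventuallyEq ?_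
      have : ∀ᶠ y in nhds x, ‖y‖ ^ 2 < 3 / 2 * R ^ 2 :=
        ContinuousAt.eventually_lt (by fun_prop) (by fun_prop) h
      filter_upwards [this] with y hy
      rw [hχ_zero y (Or.inl hy), zero_mul, zero_smul]
    · have hx : R ≤ ‖x‖ := by
        by_contra! hlt
        nlinarith [norm_nonneg x, sq_pos_of_pos hR]
      have hx0 : x ≠ 0 := norm_pos_iff.1 (hR.trans_le hx)
      have hτx := hτ_ne x hx
      have h1 : ContDiffAt ℝ 1 (fun y : E => ‖y‖) x := contDiffAt_norm ℝ hx0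
      have h2 : ContDiffAt ℝ 1 (fun y : E => ‖τ y‖) x := hτ_smooth.contDiffAt.norm ℝ hτx
      have h3 : ContDiffAt ℝ 1 (fun y : E => χ (‖y‖ ^ 2)) x :=
        (χ.contDiff.comp (contDiff_norm_sq ℝ)).contDiffAt
      exact (h3.mul (h1.mul (h2.inv (norm_ne_zero_iff.2 hτx)))).smul hτ_smooth.contDiffAt
  · refine HasCompactSupport.of_support_subset_isCompact (isCompact_closedBall (0 : E) (6 * R)) ?_
    intro x hx
    by_contra hx'
    apply hx
    have h6 : 6 * R < ‖x‖ := by simpa using hx'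
    simp only
    rw [hχ_zero x (Or.inr (by nlinarith)), zero_mul, zero_smul]
  · intro x
    rw [inner_smul_right, hτ_orth, mul_zero]
  · intro x
    rw [norm_smul, norm_mul, norm_mul, norm_norm, norm_inv, norm_norm,
      Real.norm_of_nonneg χ.nonneg]
    by_cases h : ‖τ x‖ = 0
    · rw [h]; simp
    · rw [mul_assoc, mul_assoc, inv_mul_cancel₀ h, mul_one]
      exact mul_le_of_le_one_left (norm_nonneg _) χ.le_one
  · intro x h1 h2
    have h : ‖τ x‖ ≠ 0 := norm_ne_zero_iff.2 (hτ_ne x (by linarith))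
    rw [hχ_one x h1 h2, one_mul, norm_smul, norm_mul, norm_norm, norm_inv, norm_norm, mul_assoc,
      inv_mul_cancel₀ h, mul_one]

end Milnor

section Quotient

variable {G : Type*} [Group G] [TopologicalSpace G] {H Γ : Subgroup G}

lemma exists_forall_exists_smul_mk_eq_of_compactSpace [IsTopologicalGroup G]
    [CompactSpace (MulAction.orbitRel.Quotient Γ (G ⧸ H))] {U : ℕ → Set G}
    (hU : ∀ n, IsOpen (U n)) (hmono : Monotone U) (hcover : ∀ g, ∃ n, g ∈ U n) :
    ∃ n, ∀ g : G, ∃ γ : Γ, ∃ k ∈ U n, γ • (k : G ⧸ H) = (g : G ⧸ H) := by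
  let π : G → MulAction.orbitRel.Quotient Γ (G ⧸ H) := fun g => Quotient.mk'' (g : G ⧸ H)
  have : ContinuousConstSMul Γ (G ⧸ H) := ⟨fun γ => continuous_const_smul (γ : G)⟩
  have hπ : IsOpenMap π :=
    (isOpenMap_quotient_mk'_mul (Γ := Γ) (T := G ⧸ H)).comp QuotientGroup.isOpenMap_coe
  have hπs : ∀ z, ∃ g, π g = z := by
    intro z
    obtain ⟨x, rfl⟩ := Quotient.mk''_surjective z
    obtain ⟨g, rfl⟩ := QuotientGroup.mk_surjective x
    exact ⟨g, rfl⟩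
  obtain ⟨n, hn⟩ := isCompact_univ.elim_directed_cover (fun n => π '' U n)
    (fun n => hπ _ (hU n))
    (fun z _ => by
      obtain ⟨g, rfl⟩ := hπs z
      obtain ⟨n, hn⟩ := hcover g
      exact Set.mem_iUnion.2 ⟨n, g, hn, rfl⟩)
    (directed_of_isDirected_le fun m n h => Set.image_mono (hmono h))
  refine ⟨n, fun g => ?_⟩
  obtain ⟨k, hk, hkg⟩ := hn (Set.mem_univ (π g))
  obtain ⟨γ, hγ⟩ := MulAction.orbitRel_apply.1 (Quotient.exact hkg.symm)
  exact ⟨γ⁻¹⁻¹, k, hk, by simpa using hγ⟩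

lemma finite_setOf_smul_mk_eq_mk [ProperlyDiscontinuousSMul Γ (G ⧸ H)] {K L : Set G}
    (hK : IsCompact K) (hL : IsCompact L) :
    {γ : Γ | ∃ k ∈ K, ∃ l ∈ L, γ • (k : G ⧸ H) = (l : G ⧸ H)}.Finite := by
  have hmk : Continuous ((↑) : G → G ⧸ H) := QuotientGroup.continuous_mk
  refine (ProperlyDiscontinuousSMul.finite_disjoint_inter_image (Γ := Γ)
    (hK.image hmk) (hL.image hmk)).subset ?_
  rintro γ ⟨k, hk, l, hl, h⟩
  exact ⟨(l : G ⧸ H), ⟨(k : G ⧸ H), ⟨k, hk, rfl⟩, h⟩, ⟨l, hl, rfl⟩⟩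

lemma isClosed_setOf_exists_mk_eq [IsTopologicalGroup G] (hH : IsClosed (H : Set G))
    {K : Set G} (hK : IsCompact K) :
    IsClosed {g : G | ∃ k ∈ K, (k : G ⧸ H) = (g : G ⧸ H)} := by
  convert hH.mul_left_of_isCompact hK using 1
  ext g
  simp only [Set.mem_ofPred_eq, Set.mem_mul, QuotientGroup.eq]
  constructor
  · rintro ⟨k, hk, h⟩
    exact ⟨k, hk, _, h, by group⟩
  · rintro ⟨k, hk, h, hh, rfl⟩
    exact ⟨k, hk, by simpa using hh⟩

end Quotient

/-- The symmetric bilinear form of signature `(p, N - p)`. -/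
def signatureForm (p N : ℕ) : LinearMap.BilinForm ℝ (Fin N → ℝ) :=
  Matrix.toBilin' (signatureMatrix p N)

section SignatureForm

variable {p N : ℕ}

lemma signatureForm_eq_dotProduct (x y : Fin N → ℝ) :
    signatureForm p N x y = x ⬝ᵥ signatureMatrix p N *ᵥ y :=
  Matrix.toBilin'_apply' _ _ _

lemma signatureForm_apply (x y : Fin N → ℝ) :
    signatureForm p N x y = ∑ i : Fin N, (if (i : ℕ) < p then x i * y i else -(x i * y i)) := by
  rw [signatureForm_eq_dotProduct]
  simp only [dotProduct, signatureMatrix, Matrix.mulVec_diagonal]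
  refine Finset.sum_congr rfl fun i _ => ?_
  split_ifs <;> ring

lemma signatureForm_comm (x y : Fin N → ℝ) : signatureForm p N x y = signatureForm p N y x := by
  simp only [signatureForm_apply, mul_comm]

lemma signatureForm_mulVec_mulVec (A : Matrix (Fin N) (Fin N) ℝ) (x y : Fin N → ℝ) :
    signatureForm p N (A *ᵥ x) (A *ᵥ y) = x ⬝ᵥ (Aᵀ * signatureMatrix p N * A) *ᵥ y := by
  rw [signatureForm_eq_dotProduct, ← Matrix.vecMul_transpose, ← Matrix.dotProduct_mulVec,
    Matrix.mulVec_mulVec, Matrix.mulVec_mulVec, Matrix.mul_assoc]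

lemma signatureForm_mulVec {A : Matrix (Fin N) (Fin N) ℝ}
    (hA : Aᵀ * signatureMatrix p N * A = signatureMatrix p N) (x y : Fin N → ℝ) :
    signatureForm p N (A *ᵥ x) (A *ᵥ y) = signatureForm p N x y := by
  rw [signatureForm_mulVec_mulVec, hA, signatureForm_eq_dotProduct]

/-- The reflection in the hyperplane orthogonal to `u` for `signatureForm`. -/
def reflectionMatrix (p : ℕ) (u : Fin N → ℝ) : Matrix (Fin N) (Fin N) ℝ :=
  1 - (2 / signatureForm p N u u) • Matrix.vecMulVec u (signatureMatrix p N *ᵥ u)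

lemma reflectionMatrix_mulVec (u x : Fin N → ℝ) :
    reflectionMatrix p u *ᵥ x = x - (2 * signatureForm p N u x / signatureForm p N u u) • u := by
  rw [reflectionMatrix, Matrix.sub_mulVec, Matrix.one_mulVec, Matrix.smul_mulVec,
    Matrix.vecMulVec_mulVec, signatureForm_comm u x, signatureForm_eq_dotProduct x u,
    dotProduct_comm x]
  ext i
  simp
  ring

lemma reflectionMatrix_det {u : Fin N → ℝ} (hu : signatureForm p N u u ≠ 0) :
    (reflectionMatrix p u).det = -1 := by
  have : reflectionMatrix p u = 1 + Matrix.vecMulVec ((-(2 / signatureForm p N u u)) • u)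
      (signatureMatrix p N *ᵥ u) := by
    rw [reflectionMatrix, Matrix.smul_vecMulVec, neg_smul, sub_eq_add_neg]
  rw [this, Matrix.vecMulVec_eq Unit, Matrix.det_one_add_replicateCol_mul_replicateRow,
    dotProduct_smul, dotProduct_comm, ← signatureForm_eq_dotProduct]
  simp only [smul_eq_mul]
  field_simp
  norm_num

lemma reflectionMatrix_transpose_mul {u : Fin N → ℝ} (hu : signatureForm p N u u ≠ 0) :
    (reflectionMatrix p u)ᵀ * signatureMatrix p N * reflectionMatrix p u
      = signatureMatrix p N := by
  have key : ∀ x y, signatureForm p N (reflectionMatrix p u *ᵥ x) (reflectionMatrix p u *ᵥ y)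
      = signatureForm p N x y := by
    intro x y
    simp only [reflectionMatrix_mulVec, map_sub, map_smul, LinearMap.sub_apply,
      LinearMap.smul_apply, smul_eq_mul, signatureForm_comm x u]
    field_simp
    ring
  apply (Matrix.toBilin' (n := Fin N) (R₁ := ℝ)).injective
  refine LinearMap.ext fun x => LinearMap.ext fun y => ?_
  rw [← signatureForm, ← key x y, signatureForm_mulVec_mulVec, Matrix.toBilin'_apply']

lemma abs_reflectionMatrix_le (u : Fin N → ℝ) (i j : Fin N) :
    |reflectionMatrix p u i j| ≤ 1 + 2 / |signatureForm p N u u| * (|u i| * |u j|) := by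
  have h1 : |(1 : Matrix (Fin N) (Fin N) ℝ) i j| ≤ 1 := by
    rw [Matrix.one_apply]; split_ifs <;> simp
  have h2 : |(signatureMatrix p N *ᵥ u) j| = |u j| := by
    rw [signatureMatrix, Matrix.mulVec_diagonal]; split_ifs <;> simp
  rw [reflectionMatrix, Matrix.sub_apply, Matrix.smul_apply, Matrix.vecMulVec_apply]
  refine (abs_sub _ _).trans (add_le_add h1 ?_)
  rw [smul_eq_mul, abs_mul, abs_mul, h2, abs_div, abs_two]

end SignatureForm

namespace indefSO

variable {p N : ℕ}

lemma isClosedEmbedding_val :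
    Topology.IsClosedEmbedding fun g : indefSO p N => (g.val.val : Matrix (Fin N) (Fin N) ℝ) := by
  refine ⟨?_, ?_⟩
  · refine (Units.isEmbedding_val_mk' (f := fun A : Matrix (Fin N) (Fin N) ℝ =>
      (A.det)⁻¹ • A.adjugate) ?_ ?_).comp Topology.IsEmbedding.subtypeVal
    · refine ContinuousOn.smul (ContinuousOn.inv₀ continuous_id.matrix_det.continuousOn ?_)
        continuous_id.matrix_adjugate.continuousOn
      intro A hA
      exact ((Matrix.isUnit_iff_isUnit_det A).1 hA).ne_zero
    · intro u
      rw [Matrix.coe_units_inv, Matrix.inv_def, Ring.inverse_eq_inv']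
  · have : Set.range (fun g : indefSO p N => (g.val.val : Matrix (Fin N) (Fin N) ℝ))
        = {A | Aᵀ * signatureMatrix p N * A = signatureMatrix p N} ∩ {A | A.det = 1} := by
      ext A
      constructor
      · rintro ⟨g, rfl⟩
        exact g.2
      · rintro ⟨h1, h2⟩
        exact ⟨⟨Matrix.GeneralLinearGroup.mkOfDetNeZero A (by rw [h2]; exact one_ne_zero),
          h1, h2⟩, rfl⟩
    rw [this]
    have h1 : Continuous fun A : Matrix (Fin N) (Fin N) ℝ => Aᵀ * signatureMatrix p N * A := by
      fun_prop
    have h2 : Continuous fun A : Matrix (Fin N) (Fin N) ℝ => A.det := by fun_prop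
    exact (isClosed_eq h1 continuous_const).inter (isClosed_eq h2 continuous_const)

lemma continuous_val :
    Continuous fun g : indefSO p N => (g.val.val : Matrix (Fin N) (Fin N) ℝ) :=
  isClosedEmbedding_val.continuous

/-- The elements of `indefSO p N` with entries bounded by `c`. -/
def bounded (p N : ℕ) (c : ℝ) : Set (indefSO p N) := {g | ∀ i j, |g.val.val i j| ≤ c}

lemma isCompact_bounded (c : ℝ) : IsCompact (bounded p N c) := by
  have h : IsCompact (Set.univ.pi fun _ : Fin N => Set.univ.pi fun _ : Fin N => Set.Icc (-c) c) :=
    isCompact_univ_pi fun _ => isCompact_univ_pi fun _ => isCompact_Icc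
  convert isClosedEmbedding_val.isCompact_preimage h using 1
  ext g
  exact ⟨fun hg i _ j _ => abs_le.1 (hg i j), fun hg i j => abs_le.2 (hg i trivial j trivial)⟩

lemma isClosed_indefSOsub (p q r : ℕ) :
    IsClosed (indefSOsub p q r : Set (indefSO p (p + q + r))) := by
  have : (indefSOsub p q r : Set (indefSO p (p + q + r))) = ⋂ i : Fin (p + q + r),
      ⋂ _ : p + q ≤ (i : ℕ), {A | A.val.val *ᵥ Pi.single i 1 = Pi.single i 1} := by
    ext A
    simp only [Set.mem_iInter]
    rfl
  rw [this]
  refine isClosed_iInter fun i => isClosed_iInter fun _ => isClosed_eq ?_ continuous_const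
  have := continuous_val (p := p) (N := p + q + r)
  fun_prop

lemma mk_eq_mk_iff {p q r : ℕ} {g g' : indefSO p (p + q + r)} :
    (g : indefSO p (p + q + r) ⧸ indefSOsub p q r) = g' ↔ ∀ i : Fin (p + q + r), p + q ≤ (i : ℕ) →
      g.val.val *ᵥ Pi.single i 1 = g'.val.val *ᵥ Pi.single i 1 := by
  rw [QuotientGroup.eq]
  have h : ∀ i : Fin (p + q + r), (g⁻¹ * g').val.val *ᵥ Pi.single i 1 = Pi.single i 1 ↔
      g.val.val *ᵥ Pi.single i 1 = g'.val.val *ᵥ Pi.single i 1 := by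
    intro i
    have h1 : (g⁻¹ * g').val.val = (g⁻¹).val.val * g'.val.val := rfl
    have h2 : (g⁻¹).val.val * g.val.val = 1 := g.val.inv_mul
    have h3 : g.val.val * (g⁻¹).val.val = 1 := g.val.mul_inv
    rw [h1, ← Matrix.mulVec_mulVec]
    constructor
    · intro h
      rw [← congrArg (g.val.val *ᵥ ·) h]
      simp only [Matrix.mulVec_mulVec, h3, ← Matrix.mul_assoc, Matrix.one_mul]
    · intro h
      rw [← h, Matrix.mulVec_mulVec, h2, Matrix.one_mulVec]
  exact forall₂_congr fun i _ => h i

lemma inv_mulVec_mulVec (g : indefSO p N) (x : Fin N → ℝ) :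
    (g⁻¹).val.val *ᵥ (g.val.val *ᵥ x) = x := by
  have h2 : (g⁻¹).val.val * g.val.val = 1 := g.val.inv_mul
  rw [Matrix.mulVec_mulVec, h2, Matrix.one_mulVec]

lemma mulVec_inv_mulVec (g : indefSO p N) (x : Fin N → ℝ) :
    g.val.val *ᵥ ((g⁻¹).val.val *ᵥ x) = x := by
  have h2 : g.val.val * (g⁻¹).val.val = 1 := g.val.mul_inv
  rw [Matrix.mulVec_mulVec, h2, Matrix.one_mulVec]

lemma mul_mulVec (g g' : indefSO p N) (x : Fin N → ℝ) :
    (g * g').val.val *ᵥ x = g.val.val *ᵥ (g'.val.val *ᵥ x) :=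
  (Matrix.mulVec_mulVec _ _ _).symm

lemma signatureForm_mulVec (g : indefSO p N) (x y : Fin N → ℝ) :
    signatureForm p N (g.val.val *ᵥ x) (g.val.val *ᵥ y) = signatureForm p N x y :=
  _root_.signatureForm_mulVec g.2.1 x y

lemma signatureForm_add_self_le {a b : Fin N → ℝ} (ha : signatureForm p N a a = -1)
    (hb : signatureForm p N b b = -1) (hab : signatureForm p N a b ≤ 0) :
    signatureForm p N (a + b) (a + b) ≤ -2 := by
  simp only [map_add, LinearMap.add_apply, signatureForm_comm b a]
  linarith

/-- An element of `indefSO p N` carrying `a` to `b` and fixing the vectors orthogonal to both. -/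
def rotation (a b : Fin N → ℝ) (ha : signatureForm p N a a = -1)
    (hb : signatureForm p N b b = -1) (hab : signatureForm p N a b ≤ 0) : indefSO p N :=
  ⟨Matrix.GeneralLinearGroup.mkOfDetNeZero (reflectionMatrix p (a + b) * reflectionMatrix p a) (by
    have := signatureForm_add_self_le ha hb hab
    rw [Matrix.det_mul, reflectionMatrix_det (by linarith), reflectionMatrix_det (by linarith)]
    norm_num), by
    have := signatureForm_add_self_le ha hb hab
    constructor
    · change (reflectionMatrix p (a + b) * reflectionMatrix p a)ᵀ * _ *
        (reflectionMatrix p (a + b) * reflectionMatrix p a) = _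
      calc _ = (reflectionMatrix p a)ᵀ * ((reflectionMatrix p (a + b))ᵀ * signatureMatrix p N *
            reflectionMatrix p (a + b)) * reflectionMatrix p a := by
            rw [Matrix.transpose_mul]; simp only [Matrix.mul_assoc]
        _ = _ := by
          rw [reflectionMatrix_transpose_mul (by linarith),
            reflectionMatrix_transpose_mul (by linarith)]
    · change (reflectionMatrix p (a + b) * reflectionMatrix p a).det = 1
      rw [Matrix.det_mul, reflectionMatrix_det (by linarith), reflectionMatrix_det (by linarith)]
      norm_num⟩

variable {a b : Fin N → ℝ} (ha : signatureForm p N a a = -1)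
    (hb : signatureForm p N b b = -1) (hab : signatureForm p N a b ≤ 0)

lemma rotation_val : (rotation a b ha hb hab).val.val =
    reflectionMatrix p (a + b) * reflectionMatrix p a := rfl

lemma rotation_mulVec_self : (rotation a b ha hb hab).val.val *ᵥ a = b := by
  have h := signatureForm_add_self_le ha hb hab
  have h1 : 2 * signatureForm p N (a + b) a / signatureForm p N (a + b) (a + b) = 1 := by
    rw [div_eq_one_iff_eq (by linarith)]
    simp only [map_add, LinearMap.add_apply, signatureForm_comm b a]
    linarith
  rw [rotation_val, ← Matrix.mulVec_mulVec, reflectionMatrix_mulVec a, ha,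
    show a - (2 * -1 / -1 : ℝ) • a = -a by ext; simp; ring, Matrix.mulVec_neg,
    reflectionMatrix_mulVec, h1]
  simp

lemma rotation_mulVec_of_orthogonal {x : Fin N → ℝ} (hxa : signatureForm p N a x = 0)
    (hxb : signatureForm p N b x = 0) : (rotation a b ha hb hab).val.val *ᵥ x = x := by
  rw [rotation_val, ← Matrix.mulVec_mulVec, reflectionMatrix_mulVec a, hxa,
    reflectionMatrix_mulVec]
  simp [hxa, hxb]

lemma abs_mul_apply_le {A B : Matrix (Fin N) (Fin N) ℝ} {c d : ℝ} (hc : 0 ≤ c)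
    (hA : ∀ i j, |A i j| ≤ c) (hB : ∀ i j, |B i j| ≤ d) (i j : Fin N) :
    |(A * B) i j| ≤ N * (c * d) := by
  rw [Matrix.mul_apply]
  refine (Finset.abs_sum_le_sum_abs _ _).trans ((Finset.sum_le_card_nsmul _ _ (c * d) ?_).trans ?_)
  · intro k _
    rw [abs_mul]
    exact mul_le_mul (hA i k) (hB k j) (abs_nonneg _) hc
  · simp

lemma mul_mem_bounded {g g' : indefSO p N} {c d : ℝ} (hc : 0 ≤ c) (hg : g ∈ bounded p N c)
    (hg' : g' ∈ bounded p N d) : g * g' ∈ bounded p N (N * (c * d)) :=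
  fun i j => abs_mul_apply_le hc hg hg' i j

lemma rotation_mem_bounded {C : ℝ} (hC : 0 ≤ C) (haC : ∀ i, |a i| ≤ C) (hbC : ∀ i, |b i| ≤ C) :
    rotation a b ha hb hab ∈ bounded p N (N * ((1 + 4 * C ^ 2) * (1 + 2 * C ^ 2))) := by
  refine fun i j => abs_mul_apply_le (by positivity) ?_ ?_ i j
  · intro i j
    have h := signatureForm_add_self_le ha hb hab
    have hab' : ∀ i, |(a + b) i| ≤ 2 * C := fun i =>
      (abs_add_le _ _).trans (by linarith [haC i, hbC i])
    refine (abs_reflectionMatrix_le (p := p) _ i j).trans ?_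
    have h2 : 2 / |signatureForm p N (a + b) (a + b)| ≤ 1 := by
      rw [div_le_one₀ (abs_pos.2 (by linarith)), abs_of_neg (by linarith)]
      linarith
    have h3 : |(a + b) i| * |(a + b) j| ≤ (2 * C) * (2 * C) :=
      mul_le_mul (hab' i) (hab' j) (abs_nonneg _) (by positivity)
    have h4 := mul_le_mul h2 h3 (by positivity) zero_le_one
    linarith
  · intro i j
    refine (abs_reflectionMatrix_le (p := p) _ i j).trans ?_
    rw [ha]
    have h3 : |a i| * |a j| ≤ C * C := mul_le_mul (haC i) (haC j) (abs_nonneg _) hC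
    norm_num
    linarith

end indefSO

lemma signatureForm_self_eq_neg {p N : ℕ} {x : Fin N → ℝ}
    (hx : ∀ i : Fin N, (i : ℕ) < p → x i = 0) : signatureForm p N x x = -(x ⬝ᵥ x) := by
  rw [signatureForm_apply, dotProduct, ← Finset.sum_neg_distrib]
  refine Finset.sum_congr rfl fun i _ => ?_
  split_ifs with h
  · simp [hx i h]
  · rfl

namespace indefSO

variable {p N : ℕ}

lemma exists_subset_bounded {K : Set (indefSO p N)} (hK : IsCompact K) :
    ∃ C, 0 ≤ C ∧ K ⊆ bounded p N C := by
  have hcont : Continuous fun g : indefSO p N => ∑ i, ∑ j, |g.val.val i j| := by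
    have := continuous_val (p := p) (N := N)
    refine continuous_finsetSum _ fun i _ => continuous_finsetSum _ fun j _ => ?_
    exact (this.matrix_elem i j).abs
  obtain ⟨C, hC⟩ := hK.exists_bound_of_continuousOn hcont.continuousOn
  refine ⟨max C 0, le_max_right _ _, fun g hg i j => le_max_of_le_left ?_⟩
  refine le_trans ?_ ((le_abs_self _).trans (hC g hg))
  refine le_trans ?_ (Finset.single_le_sum (f := fun i => ∑ j, |g.val.val i j|)
    (fun i _ => Finset.sum_nonneg fun j _ => abs_nonneg _) (Finset.mem_univ i))
  exact Finset.single_le_sum (f := fun j => |g.val.val i j|) (fun j _ => abs_nonneg _)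
    (Finset.mem_univ j)

lemma dotProduct_mulVec_self_le {g : indefSO p N} {C : ℝ} (hg : g ∈ bounded p N C)
    (x : Fin N → ℝ) :
    (g.val.val *ᵥ x) ⬝ᵥ (g.val.val *ᵥ x) ≤ (N * (N * C ^ 2)) * (x ⬝ᵥ x) := by
  have h : ∀ i, (g.val.val *ᵥ x) i * (g.val.val *ᵥ x) i ≤ N * C ^ 2 * (x ⬝ᵥ x) := by
    intro i
    rw [← sq]
    refine (Finset.sum_mul_sq_le_sq_mul_sq Finset.univ (fun j => g.val.val i j) x).trans ?_
    simp only [dotProduct, ← sq]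
    refine mul_le_mul_of_nonneg_right ?_ (Finset.sum_nonneg fun j _ => sq_nonneg _)
    refine (Finset.sum_le_card_nsmul _ _ (C ^ 2) fun j _ => ?_).trans (by simp)
    exact sq_le_sq.2 ((hg i j).trans (le_abs_self _))
  refine (Finset.sum_le_card_nsmul _ _ _ fun i _ => h i).trans ?_
  simp [mul_assoc]

lemma exists_mulVec_eq (g : indefSO p N) (z : Fin N → ℝ) :
    ∃ x : Fin N → ℝ, (∀ i : Fin N, (i : ℕ) < p → x i = 0) ∧
      ∀ i : Fin N, p ≤ (i : ℕ) → (g.val.val *ᵥ x) i = z i := by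
  let P : Matrix (Fin N) (Fin N) ℝ := Matrix.diagonal fun i => if (i : ℕ) < p then 0 else 1
  let L : (Fin N → ℝ) →ₗ[ℝ] (Fin N → ℝ) := (P * g.val.val * P + (1 - P)).mulVecLin
  have hL : ∀ x i, L x i = if (i : ℕ) < p then x i else (g.val.val *ᵥ (P *ᵥ x)) i := by
    intro x i
    simp only [L, Matrix.mulVecLin_apply, Matrix.add_mulVec, Matrix.sub_mulVec, Matrix.one_mulVec,
      ← Matrix.mulVec_mulVec, Pi.add_apply, Pi.sub_apply]
    simp only [P, Matrix.mulVec_diagonal]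
    split_ifs <;> simp
  have hP : ∀ x : Fin N → ℝ, (∀ i : Fin N, (i : ℕ) < p → x i = 0) → P *ᵥ x = x := by
    intro x hx
    ext i
    simp only [P, Matrix.mulVec_diagonal]
    split_ifs with h
    · simp [hx i h]
    · simp
  have hinj : Function.Injective L := by
    refine (injective_iff_map_eq_zero L).2 fun x hx => ?_
    have h0 : ∀ i : Fin N, (i : ℕ) < p → x i = 0 := by
      intro i hi
      have := congrFun hx i
      rwa [hL, if_pos hi] at this
    have h1 : ∀ i : Fin N, ¬ (i : ℕ) < p → (g.val.val *ᵥ x) i = 0 := by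
      intro i hi
      have := congrFun hx i
      rwa [hL, if_neg hi, hP x h0] at this
    have h2 := signatureForm_mulVec g x x
    have h3 : 0 ≤ signatureForm p N (g.val.val *ᵥ x) (g.val.val *ᵥ x) := by
      rw [signatureForm_apply]
      refine Finset.sum_nonneg fun i _ => ?_
      split_ifs with h
      · exact mul_self_nonneg _
      · simp [h1 i h]
    have h4 := signatureForm_self_eq_neg h0
    have h5 : 0 ≤ x ⬝ᵥ x := Finset.sum_nonneg fun i _ => mul_self_nonneg _
    exact dotProduct_self_eq_zero.1 (by linarith)
  obtain ⟨x, hx⟩ := LinearMap.injective_iff_surjective.1 hinj (P *ᵥ z)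
  have h0 : ∀ i : Fin N, (i : ℕ) < p → x i = 0 := by
    intro i hi
    have := congrFun hx i
    rw [hL, if_pos hi] at this
    simpa [P, Matrix.mulVec_diagonal, hi] using this
  refine ⟨x, h0, fun i hi => ?_⟩
  have := congrFun hx i
  rw [hL, if_neg hi.not_gt, hP x h0] at this
  simpa [P, Matrix.mulVec_diagonal, hi.not_gt] using this

end indefSO

lemma signatureForm_single {p N : ℕ} {i : Fin N} (hi : p ≤ (i : ℕ)) (x : Fin N → ℝ) :
    signatureForm p N (Pi.single i 1) x = -x i := by
  rw [signatureForm_apply, Finset.sum_eq_single i]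
  · simp [hi.not_gt]
  · intro j _ hj
    simp [hj]
  · simp

/-- The embedding of `ℝᵖ` in `ℝᴺ` as the span of the first `p` basis vectors. -/
def embedPositive (p N : ℕ) : EuclideanSpace ℝ (Fin p) →ₗ[ℝ] (Fin N → ℝ) where
  toFun y i := if h : (i : ℕ) < p then y ⟨i, h⟩ else 0
  map_add' x y := by ext i; simp only [Pi.add_apply]; split_ifs <;> simp
  map_smul' a y := by ext i; simp only [Pi.smul_apply]; split_ifs <;> simp

section EmbedPositive

variable {p N : ℕ}

lemma embedPositive_apply_of_le (y : EuclideanSpace ℝ (Fin p)) {i : Fin N} (hi : p ≤ (i : ℕ)) :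
    embedPositive p N y i = 0 := dif_neg hi.not_gt

lemma exists_eq_embedPositive (hpN : p ≤ N) {x : Fin N → ℝ}
    (hx : ∀ i : Fin N, p ≤ (i : ℕ) → x i = 0) : ∃ y, embedPositive p N y = x := by
  refine ⟨WithLp.toLp 2 fun i => x (Fin.castLE hpN i), ?_⟩
  ext i
  by_cases h : (i : ℕ) < p
  · exact dif_pos h
  · rw [embedPositive_apply_of_le _ (not_lt.1 h), hx i (not_lt.1 h)]

lemma signatureForm_embedPositive (hpN : p ≤ N) (x y : EuclideanSpace ℝ (Fin p)) :
    signatureForm p N (embedPositive p N x) (embedPositive p N y) = inner ℝ x y := by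
  obtain ⟨m, rfl⟩ := Nat.exists_eq_add_of_le hpN
  rw [signatureForm_apply, Fin.sum_univ_add, PiLp.inner_apply]
  simp [embedPositive, mul_comm]

end EmbedPositive

/-- The point of the hyperboloid `B(x, x) = -1` over `y`, in the direction of the `i`-th vector. -/
def hyperboloidLift {p N : ℕ} (i : Fin N) (y : EuclideanSpace ℝ (Fin p)) : Fin N → ℝ :=
  √(1 + ‖y‖ ^ 2) • Pi.single i 1 + embedPositive p N y

/-- A vector orthogonal to `hyperboloidLift i y` whose `j`-th coordinate is `1`. -/
def tangentLift {p N : ℕ} (i j : Fin N) (y w : EuclideanSpace ℝ (Fin p)) : Fin N → ℝ :=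
  Pi.single j 1 + embedPositive p N w + (inner ℝ w y : ℝ) • hyperboloidLift i y

section Lift

variable {p N : ℕ} {i j : Fin N}

lemma continuous_embedPositive : Continuous (embedPositive p N) :=
  LinearMap.continuous_of_finiteDimensional _

lemma continuous_hyperboloidLift :
    Continuous fun y : EuclideanSpace ℝ (Fin p) => hyperboloidLift i y := by
  have := continuous_embedPositive (p := p) (N := N)
  unfold hyperboloidLift
  fun_prop

lemma continuous_tangentLift (w : EuclideanSpace ℝ (Fin p)) :
    Continuous fun y => tangentLift i j y w := by
  have := continuous_hyperboloidLift (p := p) (i := i)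
  unfold tangentLift
  fun_prop

lemma signatureForm_single_hyperboloidLift (hi : p ≤ (i : ℕ)) (y : EuclideanSpace ℝ (Fin p)) :
    signatureForm p N (Pi.single i 1) (hyperboloidLift i y) = -√(1 + ‖y‖ ^ 2) := by
  rw [signatureForm_single hi]
  simp [hyperboloidLift, embedPositive_apply_of_le y hi]

lemma signatureForm_single_hyperboloidLift_of_ne (hj : p ≤ (j : ℕ)) (hij : i ≠ j)
    (y : EuclideanSpace ℝ (Fin p)) :
    signatureForm p N (Pi.single j 1) (hyperboloidLift i y) = 0 := by
  rw [signatureForm_single hj]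
  simp [hyperboloidLift, embedPositive_apply_of_le y hj, hij.symm]

lemma signatureForm_single_embedPositive (hi : p ≤ (i : ℕ)) (y : EuclideanSpace ℝ (Fin p)) :
    signatureForm p N (Pi.single i 1) (embedPositive p N y) = 0 := by
  rw [signatureForm_single hi, embedPositive_apply_of_le y hi, neg_zero]

lemma signatureForm_single_single (hi : p ≤ (i : ℕ)) :
    signatureForm p N (Pi.single i 1) (Pi.single i 1) = -1 := by
  rw [signatureForm_single hi, Pi.single_eq_same]

lemma signatureForm_embedPositive_hyperboloidLift (hi : p ≤ (i : ℕ))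
    (x y : EuclideanSpace ℝ (Fin p)) :
    signatureForm p N (embedPositive p N x) (hyperboloidLift i y) = inner ℝ x y := by
  rw [hyperboloidLift, map_add, map_smul, signatureForm_embedPositive (hi.trans i.2.le),
    signatureForm_comm, signatureForm_single_embedPositive hi]
  simp

lemma sq_sqrt_one_add_norm_sq (y : EuclideanSpace ℝ (Fin p)) :
    √(1 + ‖y‖ ^ 2) ^ 2 = 1 + ‖y‖ ^ 2 := Real.sq_sqrt (by positivity)

lemma signatureForm_hyperboloidLift (hi : p ≤ (i : ℕ)) (y : EuclideanSpace ℝ (Fin p)) :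
    signatureForm p N (hyperboloidLift i y) (hyperboloidLift i y) = -1 := by
  conv_lhs => enter [1]; rw [hyperboloidLift]
  rw [map_add, map_smul, LinearMap.add_apply, LinearMap.smul_apply,
    signatureForm_single_hyperboloidLift hi, signatureForm_embedPositive_hyperboloidLift hi,
    real_inner_self_eq_norm_sq, smul_eq_mul]
  linarith [sq_sqrt_one_add_norm_sq y]

lemma signatureForm_tangentLift (hi : p ≤ (i : ℕ)) (hj : p ≤ (j : ℕ)) (hij : i ≠ j)
    (y w : EuclideanSpace ℝ (Fin p)) :
    signatureForm p N (tangentLift i j y w) (tangentLift i j y w)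
      = -1 + ‖w‖ ^ 2 + (inner ℝ w y : ℝ) ^ 2 := by
  simp only [tangentLift, map_add, map_smul, LinearMap.add_apply, LinearMap.smul_apply,
    signatureForm_hyperboloidLift hi, signatureForm_single_hyperboloidLift_of_ne hj hij,
    signatureForm_embedPositive_hyperboloidLift hi, signatureForm_single_single hj,
    signatureForm_single_embedPositive hj, signatureForm_embedPositive (hi.trans i.2.le),
    signatureForm_comm (hyperboloidLift i y), signatureForm_comm _ (Pi.single j 1),
    real_inner_self_eq_norm_sq, smul_eq_mul]
  ring

lemma tangentLift_smul (y : EuclideanSpace ℝ (Fin p)) (l : ℝ) :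
    tangentLift i j y (l • y) = (Pi.single j 1 - (l * √(1 + ‖y‖ ^ 2)) • Pi.single i 1)
      + (l * (1 + ‖y‖ ^ 2)) • hyperboloidLift i y := by
  have h : embedPositive p N y
      = hyperboloidLift i y - √(1 + ‖y‖ ^ 2) • (Pi.single i 1 : Fin N → ℝ) := by
    simp [hyperboloidLift]
  rw [tangentLift, inner_smul_left, real_inner_self_eq_norm_sq, map_smul, h]
  simp only [RCLike.conj_to_real]
  module

lemma tangentLift_apply_same (hj : p ≤ (j : ℕ)) (hij : i ≠ j) (y w : EuclideanSpace ℝ (Fin p)) :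
    tangentLift i j y w j = 1 := by
  simp [tangentLift, hyperboloidLift, embedPositive_apply_of_le _ hj, hij.symm]

/-- The values of `w` for which `tangentLift i j y w` is negative with respect to a perturbation of
the signature form form a convex set. -/
lemma convex_setOf_signatureForm_tangentLift_lt (hi : p ≤ (i : ℕ)) (A : Matrix (Fin N) (Fin N) ℝ)
    {δ : ℝ} (hδ : 0 ≤ δ) (y : EuclideanSpace ℝ (Fin p)) :
    Convex ℝ {w | signatureForm p N (tangentLift i j y w) (tangentLift i j y w)
      + δ * ((A *ᵥ tangentLift i j y w) ⬝ᵥ (A *ᵥ tangentLift i j y w)) < 0} := by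
  let D : LinearMap.BilinForm ℝ (Fin N → ℝ) :=
    signatureForm p N + δ • Matrix.toBilin' (Aᵀ * A)
  have hD : ∀ v, D v v = signatureForm p N v v + δ * ((A *ᵥ v) ⬝ᵥ (A *ᵥ v)) := by
    intro v
    simp only [D, LinearMap.add_apply, LinearMap.smul_apply, Matrix.toBilin'_apply', smul_eq_mul]
    rw [← Matrix.mulVec_mulVec, Matrix.dotProduct_mulVec, Matrix.vecMul_transpose]
  simp only [← hD]
  intro w hw w' hw' a b ha hb hab
  simp only [Set.mem_ofPred_eq] at hw hw' ⊢
  have hdiff : tangentLift i j y w - tangentLift i j y w'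
      = embedPositive p N (w - w') + (inner ℝ (w - w') y : ℝ) • hyperboloidLift i y := by
    simp only [tangentLift, map_sub, inner_sub_left]
    module
  have hpos : 0 ≤ D (tangentLift i j y w - tangentLift i j y w')
      (tangentLift i j y w - tangentLift i j y w') := by
    rw [hD]
    refine add_nonneg ?_ (mul_nonneg hδ (Finset.sum_nonneg fun _ _ => mul_self_nonneg _))
    rw [hdiff]
    simp only [map_add, map_smul, LinearMap.add_apply, LinearMap.smul_apply,
      signatureForm_hyperboloidLift hi, signatureForm_embedPositive_hyperboloidLift hi,
      signatureForm_comm (hyperboloidLift i y), signatureForm_embedPositive (hi.trans i.2.le),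
      real_inner_self_eq_norm_sq, smul_eq_mul]
    nlinarith [sq_nonneg ‖w - w'‖, sq_nonneg (inner ℝ (w - w') y : ℝ)]
  have hcomb : tangentLift i j y (a • w + b • w')
      = a • tangentLift i j y w + b • tangentLift i j y w' := by
    have e : (Pi.single j 1 : Fin N → ℝ) = a • Pi.single j 1 + b • Pi.single j 1 := by
      rw [← add_smul, hab, one_smul]
    simp only [tangentLift, map_add, map_smul, inner_add_left, real_inner_smul_left]
    conv_lhs => rw [e]
    module
  rw [hcomb]
  set v := tangentLift i j y w
  set v' := tangentLift i j y w'
  have hid : D (a • v + b • v') (a • v + b • v')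
      = a * D v v + b * D v' v' - a * b * D (v - v') (v - v') := by
    obtain rfl : b = 1 - a := by linarith
    simp only [map_add, map_sub, map_smul, LinearMap.add_apply, LinearMap.sub_apply,
      LinearMap.smul_apply, smul_eq_mul]
    ring
  rw [hid]
  have := mul_nonneg (mul_nonneg ha hb) hpos
  rcases ha.eq_or_lt with rfl | ha'
  · obtain rfl : b = 1 := by linarith
    linarith
  · nlinarith [mul_neg_of_pos_of_neg ha' hw,
      mul_nonneg_of_nonpos_of_nonpos hw'.le (neg_nonpos.2 hb)]

/-- An element of `indefSO p N` carrying `Pi.single i 1` to `hyperboloidLift i y`. -/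
def indefSO.frame (hi : p ≤ (i : ℕ)) (y : EuclideanSpace ℝ (Fin p)) : indefSO p N :=
  indefSO.rotation (Pi.single i 1) (hyperboloidLift i y) (signatureForm_single_single hi)
    (signatureForm_hyperboloidLift hi y)
    (by rw [signatureForm_single_hyperboloidLift hi]; simp)

lemma indefSO.frame_mulVec_single (hi : p ≤ (i : ℕ)) (y : EuclideanSpace ℝ (Fin p)) :
    (indefSO.frame hi y).val.val *ᵥ Pi.single i 1 = hyperboloidLift i y :=
  indefSO.rotation_mulVec_self _ _ _

lemma indefSO.frame_mulVec_single_of_ne (hi : p ≤ (i : ℕ)) (hj : p ≤ (j : ℕ)) (hij : i ≠ j)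
    (y : EuclideanSpace ℝ (Fin p)) :
    (indefSO.frame hi y).val.val *ᵥ Pi.single j 1 = Pi.single j 1 :=
  indefSO.rotation_mulVec_of_orthogonal _ _ _ (by rw [signatureForm_single hi]; simp [hij])
    (by rw [signatureForm_comm, signatureForm_single_hyperboloidLift_of_ne hj hij])

lemma indefSO.continuous_frame (hi : p ≤ (i : ℕ)) :
    Continuous fun y : EuclideanSpace ℝ (Fin p) => indefSO.frame hi y := by
  refine indefSO.isClosedEmbedding_val.isInducing.continuous_iff.2 ?_
  have hlift := continuous_hyperboloidLift (p := p) (i := i)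
  have hform : Continuous fun x : Fin N → ℝ => signatureForm p N x x := by
    simp only [signatureForm_eq_dotProduct]
    fun_prop
  have hne : ∀ y : EuclideanSpace ℝ (Fin p), signatureForm p N
      (Pi.single i 1 + hyperboloidLift i y) (Pi.single i 1 + hyperboloidLift i y) ≠ 0 := by
    intro y
    have := indefSO.signatureForm_add_self_le (signatureForm_single_single hi)
      (signatureForm_hyperboloidLift hi y)
      (by rw [signatureForm_single_hyperboloidLift hi]; simp)
    linarith
  refine Continuous.mul ?_ continuous_const
  refine continuous_const.sub (Continuous.smul (continuous_const.div
    (hform.comp (continuous_const.add hlift)) hne) ?_)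
  fun_prop

end Lift

namespace indefSO

variable {p q r : ℕ} {Γ : Subgroup (indefSO p (p + q + r))} {i j : Fin (p + q + r)}

/-- The vectors `w` such that `tangentLift i j y w` and all its translates by `γ⁻¹`, where `γ`
carries a bounded element to `frame hi y` modulo `indefSOsub p q r`, are uniformly negative. -/
def admissible (Γ : Subgroup (indefSO p (p + q + r))) (c δ : ℝ) (hi : p ≤ (i : ℕ))
    (j : Fin (p + q + r)) (y : EuclideanSpace ℝ (Fin p)) : Set (EuclideanSpace ℝ (Fin p)) :=
  {w | ∀ γ : Γ, (∃ k ∈ bounded p (p + q + r) c,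
      γ • (k : indefSO p (p + q + r) ⧸ indefSOsub p q r) = frame hi y) →
    signatureForm p (p + q + r) (tangentLift i j y w) (tangentLift i j y w)
      + δ * (((γ : indefSO p (p + q + r))⁻¹.val.val *ᵥ tangentLift i j y w) ⬝ᵥ
        ((γ : indefSO p (p + q + r))⁻¹.val.val *ᵥ tangentLift i j y w)) < 0}

lemma convex_admissible {c δ : ℝ} (hδ : 0 ≤ δ) (hi : p ≤ (i : ℕ))
    (y : EuclideanSpace ℝ (Fin p)) : Convex ℝ (admissible Γ c δ hi j y) := by
  simp only [admissible, Set.ofPred_forall]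
  exact convex_iInter fun γ => convex_iInter fun _ =>
    convex_setOf_signatureForm_tangentLift_lt hi _ hδ y

lemma exists_forall_nonempty_admissible
    [ProperlyDiscontinuousSMul Γ (indefSO p (p + q + r) ⧸ indefSOsub p q r)] {c : ℝ}
    (hcov : ∀ g : indefSO p (p + q + r), ∃ γ : Γ, ∃ k ∈ bounded p (p + q + r) c,
      γ • (k : indefSO p (p + q + r) ⧸ indefSOsub p q r) = g)
    (hi : p + q ≤ (i : ℕ)) (hj : p ≤ (j : ℕ)) (hij : i ≠ j) :
    ∃ δ > 0, ∀ y, (admissible Γ c δ ((Nat.le_add_right p q).trans hi) j y).Nonempty := by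
  have hi' := (Nat.le_add_right p q).trans hi
  have hfin := finite_setOf_smul_mk_eq_mk (H := indefSOsub p q r) (Γ := Γ)
    (isCompact_bounded (p := p) (N := p + q + r) c) (isCompact_bounded c)
  obtain ⟨C, hC0, hC⟩ := exists_subset_bounded (hfin.image Subtype.val).isCompact
  set N : ℝ := ((p + q + r : ℕ) : ℝ)
  have hM : 0 ≤ N * (N * (N * (C * c)) ^ 2) := by positivity
  refine ⟨(1 + N * (N * (N * (C * c)) ^ 2))⁻¹, by positivity, fun y => ?_⟩
  obtain ⟨γ₀, k, hk, hγ₀⟩ := hcov (frame hi' y)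
  obtain ⟨n, hn, hn'⟩ := exists_mulVec_eq ((γ₀ : indefSO p (p + q + r)) * k) (Pi.single j 1)
  obtain ⟨w, hw⟩ := exists_eq_embedPositive (p := p) (N := p + q + r) (by omega)
    (x := ((γ₀ : indefSO p (p + q + r)) * k).val.val *ᵥ n - Pi.single j 1)
    (fun m hm => by rw [Pi.sub_apply, hn' m hm, sub_self])
  refine ⟨w, fun γ hγ => ?_⟩
  set v := tangentLift i j y w with hv
  set m := n + (inner ℝ w y : ℝ) • (Pi.single i 1 : Fin (p + q + r) → ℝ) with hm
  have hlift : ((γ₀ : indefSO p (p + q + r)) * k).val.val *ᵥ Pi.single i 1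
      = hyperboloidLift i y := by
    rw [← frame_mulVec_single hi' y]
    exact mk_eq_mk_iff.1 hγ₀ i hi
  have hvm : v = ((γ₀ : indefSO p (p + q + r)) * k).val.val *ᵥ m := by
    rw [hm, Matrix.mulVec_add, Matrix.mulVec_smul, hlift, hv, tangentLift, hw]
    simp
  have hm0 : ∀ l : Fin (p + q + r), (l : ℕ) < p → m l = 0 := by
    intro l hl
    have : l ≠ i := by rintro rfl; omega
    simp [hm, hn l hl, this]
  have hmpos : 0 < m ⬝ᵥ m := by
    refine lt_of_le_of_ne (Finset.sum_nonneg fun _ _ => mul_self_nonneg _) fun h => ?_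
    have h1 := tangentLift_apply_same (N := p + q + r) hj hij y w
    rw [← hv, hvm, dotProduct_self_eq_zero.1 h.symm, Matrix.mulVec_zero] at h1
    simp at h1
  have hB : signatureForm p (p + q + r) v v = -(m ⬝ᵥ m) := by
    rw [hvm, signatureForm_mulVec, signatureForm_self_eq_neg hm0]
  obtain ⟨k', hk', hγ⟩ := hγ
  have hσ : (γ : indefSO p (p + q + r))⁻¹ * γ₀ ∈ bounded p (p + q + r) C := by
    refine hC ⟨γ⁻¹ * γ₀, ⟨k, hk, k', hk', ?_⟩, rfl⟩
    rw [mul_smul, hγ₀, ← hγ, inv_smul_smul]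
  have hle := dotProduct_mulVec_self_le (mul_mem_bounded hC0 hσ hk) m
  have e : (γ : indefSO p (p + q + r))⁻¹.val.val *ᵥ v
      = ((γ : indefSO p (p + q + r))⁻¹ * γ₀ * k).val.val *ᵥ m := by
    rw [hvm, ← mul_mulVec, mul_assoc]
  rw [hB, e, neg_add_lt_iff_lt_add, add_zero, inv_mul_lt_iff₀ (by positivity)]
  linarith

lemma eventually_mem_admissible
    [ProperlyDiscontinuousSMul Γ (indefSO p (p + q + r) ⧸ indefSOsub p q r)] {c δ : ℝ}
    (hi : p ≤ (i : ℕ)) {y w : EuclideanSpace ℝ (Fin p)} (hw : w ∈ admissible Γ c δ hi j y) :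
    ∀ᶠ y' in nhds y, w ∈ admissible Γ c δ hi j y' := by
  have hfr := continuous_frame (p := p) (N := p + q + r) hi
  have hfin := finite_setOf_smul_mk_eq_mk (H := indefSOsub p q r) (Γ := Γ)
    (isCompact_bounded (p := p) (N := p + q + r) c)
    ((isCompact_closedBall y 1).image hfr)
  have hball : ∀ᶠ y' in nhds y, y' ∈ Metric.closedBall y 1 :=
    Metric.closedBall_mem_nhds y one_pos
  have hev : ∀ γ : Γ, ∀ᶠ y' in nhds y, (∃ k ∈ bounded p (p + q + r) c,
        γ • (k : indefSO p (p + q + r) ⧸ indefSOsub p q r) = frame hi y') →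
      signatureForm p (p + q + r) (tangentLift i j y' w) (tangentLift i j y' w)
        + δ * (((γ : indefSO p (p + q + r))⁻¹.val.val *ᵥ tangentLift i j y' w) ⬝ᵥ
          ((γ : indefSO p (p + q + r))⁻¹.val.val *ᵥ tangentLift i j y' w)) < 0 := by
    intro γ
    by_cases hγ : ∃ k ∈ bounded p (p + q + r) c,
        γ • (k : indefSO p (p + q + r) ⧸ indefSOsub p q r) = frame hi y
    · have hlift := continuous_tangentLift (p := p) (N := p + q + r) (i := i) (j := j) w
      have hcont : Continuous fun y' =>
          signatureForm p (p + q + r) (tangentLift i j y' w) (tangentLift i j y' w)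
          + δ * (((γ : indefSO p (p + q + r))⁻¹.val.val *ᵥ tangentLift i j y' w) ⬝ᵥ
            ((γ : indefSO p (p + q + r))⁻¹.val.val *ᵥ tangentLift i j y' w)) := by
        simp only [signatureForm_eq_dotProduct]
        fun_prop
      filter_upwards [hcont.continuousAt.eventually_lt continuousAt_const (hw γ hγ)] with y' h _
      exact h
    · have hcl := (isClosed_setOf_exists_mk_eq (isClosed_indefSOsub p q r)
        (isCompact_bounded c)).preimage ((continuous_const_mul
          ((γ : indefSO p (p + q + r))⁻¹)).comp hfr)
      have hiff : ∀ y', y' ∈ (fun y => (γ : indefSO p (p + q + r))⁻¹ * frame hi y) ⁻¹'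
          {g | ∃ k ∈ bounded p (p + q + r) c,
            (k : indefSO p (p + q + r) ⧸ indefSOsub p q r) = g} ↔
          ∃ k ∈ bounded p (p + q + r) c,
            γ • (k : indefSO p (p + q + r) ⧸ indefSOsub p q r) = frame hi y' := by
        intro y'
        refine exists_congr fun k => and_congr_right fun _ => ?_
        exact eq_inv_smul_iff (g := γ) (a := (k : indefSO p (p + q + r) ⧸ indefSOsub p q r))
          (b := (frame hi y' : indefSO p (p + q + r) ⧸ indefSOsub p q r))
      filter_upwards [hcl.isOpen_compl.mem_nhds fun h => hγ ((hiff y).1 h)] with y' h h'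
      exact absurd ((hiff y').2 h') h
  filter_upwards [hball, (Filter.eventually_all_finite hfin).2 fun γ _ => hev γ] with y' h1 h2 γ hγ
  obtain ⟨k, hk, h⟩ := hγ
  exact h2 γ ⟨k, hk, _, ⟨y', h1, rfl⟩, h⟩ ⟨k, hk, h⟩

lemma exists_forall_smul_mem_admissible_norm_lt
    [ProperlyDiscontinuousSMul Γ (indefSO p (p + q + r) ⧸ indefSOsub p q r)] {c δ : ℝ}
    (hδ : 0 < δ) (hcov : ∀ g : indefSO p (p + q + r), ∃ γ : Γ, ∃ k ∈ bounded p (p + q + r) c,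
      γ • (k : indefSO p (p + q + r) ⧸ indefSOsub p q r) = g)
    (hi : p + q ≤ (i : ℕ)) (hj : p ≤ (j : ℕ)) (hjq : (j : ℕ) < p + q) :
    ∃ R > 0, ∀ (y : EuclideanSpace ℝ (Fin p)) (l : ℝ),
      l • y ∈ admissible Γ c δ ((Nat.le_add_right p q).trans hi) j y → ‖y‖ < R := by
  have hi' := (Nat.le_add_right p q).trans hi
  have hij : i ≠ j := by rintro rfl; omega
  set N : ℝ := ((p + q + r : ℕ) : ℝ)
  set D := 1 + δ⁻¹ + |c| with hD
  set C₁ := N * ((1 + 4 * D ^ 2) * (1 + 2 * D ^ 2))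
  have hfin := finite_setOf_smul_mk_eq_mk (H := indefSOsub p q r) (Γ := Γ)
    (isCompact_bounded (p := p) (N := p + q + r) (N * (C₁ * c)))
    (isCompact_bounded (N * ((1 + 4 * 1 ^ 2) * (1 + 2 * 1 ^ 2))))
  obtain ⟨C, hC0, hC⟩ := exists_subset_bounded (hfin.image Subtype.val).isCompact
  refine ⟨|N * (C * c)| + 1, by positivity, fun y l hl => ?_⟩
  obtain ⟨γ, k, hk, hγ⟩ := hcov (frame hi' y)
  have hneg := hl γ ⟨k, hk, hγ⟩
  have hagree : ∀ m : Fin (p + q + r), p + q ≤ (m : ℕ) →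
      (γ : indefSO p (p + q + r)).val.val *ᵥ (k.val.val *ᵥ Pi.single m 1)
        = (frame hi' y).val.val *ᵥ Pi.single m 1 := fun m hm =>
    (mul_mulVec _ _ _).symm.trans (mk_eq_mk_iff.1 hγ m hm)
  set f := hyperboloidLift i y with hf
  set s := √(1 + ‖y‖ ^ 2) with hs
  have hs2 : s ^ 2 = 1 + ‖y‖ ^ 2 := sq_sqrt_one_add_norm_sq y
  have hs0 : 0 ≤ s := Real.sqrt_nonneg _
  set v := tangentLift i j y (l • y) with hv
  set u : Fin (p + q + r) → ℝ := Pi.single j 1 - (l * s) • Pi.single i 1 with hu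
  have hvu : v = u + (l * (1 + ‖y‖ ^ 2)) • f := tangentLift_smul y l
  obtain ⟨μ, hμ1, hμl⟩ : ∃ μ : ℝ, μ ^ 2 * (1 + l ^ 2 * s ^ 2) = 1 ∧ μ * l ≤ 0 := by
    have hpos : 0 < 1 + l ^ 2 * s ^ 2 := by positivity
    rcases le_total l 0 with h | h
    · refine ⟨(√(1 + l ^ 2 * s ^ 2))⁻¹, ?_, mul_nonpos_of_nonneg_of_nonpos (by positivity) h⟩
      rw [inv_pow, Real.sq_sqrt hpos.le, inv_mul_cancel₀ hpos.ne']
    · refine ⟨-(√(1 + l ^ 2 * s ^ 2))⁻¹, ?_, mul_nonpos_of_nonpos_of_nonneg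
        (neg_nonpos.2 (by positivity)) h⟩
      rw [neg_sq, inv_pow, Real.sq_sqrt hpos.le, inv_mul_cancel₀ hpos.ne']
  have hγk : (γ : indefSO p (p + q + r))⁻¹.val.val *ᵥ f = k.val.val *ᵥ Pi.single i 1 := by
    rw [hf, ← frame_mulVec_single hi' y, ← hagree i hi, inv_mulVec_mulVec]
  have hQ0 : 0 ≤ ((γ : indefSO p (p + q + r))⁻¹.val.val *ᵥ v) ⬝ᵥ
      ((γ : indefSO p (p + q + r))⁻¹.val.val *ᵥ v) :=
    Finset.sum_nonneg fun _ _ => mul_self_nonneg _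
  have hBv := signatureForm_tangentLift (N := p + q + r) hi' hj hij y (l • y)
  rw [norm_smul, mul_pow, Real.norm_eq_abs, sq_abs, real_inner_smul_left,
    real_inner_self_eq_norm_sq, ← hv] at hBv
  have hQ : ((γ : indefSO p (p + q + r))⁻¹.val.val *ᵥ v) ⬝ᵥ
      ((γ : indefSO p (p + q + r))⁻¹.val.val *ᵥ v) ≤ δ⁻¹ := by
    rw [← one_div δ, le_div_iff₀ hδ]
    nlinarith [sq_nonneg (l * ‖y‖), sq_nonneg (l * ‖y‖ ^ 2)]
  have hsmall : l ^ 2 * ‖y‖ ^ 2 * s ^ 2 ≤ 1 := by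
    rw [hs2]
    nlinarith [mul_nonneg hδ.le hQ0]
  have hμ_abs : |μ| ≤ 1 := by
    rw [← sq_le_one_iff_abs_le_one]
    nlinarith [mul_nonneg (sq_nonneg μ) (sq_nonneg (l * s))]
  have hμls : |μ * (l * s)| ≤ 1 := by
    rw [← sq_le_one_iff_abs_le_one]
    nlinarith [sq_nonneg μ]
  have hμlss : |μ * (l * (1 + ‖y‖ ^ 2))| ≤ 1 := by
    rw [← sq_le_one_iff_abs_le_one, ← hs2]
    have h1 : l ^ 2 * s ^ 4 ≤ 1 + l ^ 2 * s ^ 2 := by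
      have : l ^ 2 * s ^ 4 = l ^ 2 * s ^ 2 * (1 + ‖y‖ ^ 2) := by rw [← hs2]; ring
      linarith
    have h2 := mul_le_mul_of_nonneg_left h1 (sq_nonneg μ)
    linarith
  have hBu : signatureForm p (p + q + r) (μ • u) (μ • u) = -1 := by
    simp only [hu, map_sub, map_smul, LinearMap.sub_apply, LinearMap.smul_apply, smul_eq_mul,
      signatureForm_single hi', signatureForm_single hj, Pi.single_eq_same, Pi.single_apply, hij,
      hij.symm, if_false]
    linarith
  have hBe : signatureForm p (p + q + r) (Pi.single i 1) (μ • u) ≤ 0 := by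
    rw [signatureForm_single hi']
    simp only [hu, Pi.smul_apply, Pi.sub_apply, smul_eq_mul, Pi.single_eq_same, Pi.single_apply,
      hij, if_false]
    nlinarith [mul_nonneg hs0 (neg_nonneg.2 hμl)]
  have hBf : signatureForm p (p + q + r) f (μ • u) ≤ 0 := by
    rw [signatureForm_comm, hf]
    simp only [hu, map_sub, map_smul, LinearMap.sub_apply, LinearMap.smul_apply, smul_eq_mul,
      signatureForm_single_hyperboloidLift hi', ← hs,
      signatureForm_single_hyperboloidLift_of_ne hj hij]
    nlinarith [mul_nonneg (mul_nonneg hs0 hs0) (neg_nonneg.2 hμl)]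
  have hu_abs : ∀ m, |(μ • u) m| ≤ 1 := by
    intro m
    simp only [hu, Pi.smul_apply, Pi.sub_apply, smul_eq_mul, Pi.single_apply]
    rcases eq_or_ne m i with rfl | hmi
    · simpa [hij] using hμls
    · rcases eq_or_ne m j with rfl | hmj
      · simpa [hmi] using hμ_abs
      · simp [hmi, hmj]
  have he_abs : ∀ m, |(Pi.single i 1 : Fin (p + q + r) → ℝ) m| ≤ 1 := by
    intro m
    rw [Pi.single_apply]
    split_ifs <;> simp
  set a := (γ : indefSO p (p + q + r))⁻¹.val.val *ᵥ f with ha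
  set b := (γ : indefSO p (p + q + r))⁻¹.val.val *ᵥ (μ • u) with hb
  have haa : signatureForm p (p + q + r) a a = -1 := by
    rw [ha, signatureForm_mulVec, hf, signatureForm_hyperboloidLift hi']
  have hbb : signatureForm p (p + q + r) b b = -1 := by rw [hb, signatureForm_mulVec, hBu]
  have hab : signatureForm p (p + q + r) a b ≤ 0 := by rwa [ha, hb, signatureForm_mulVec]
  have ha_abs : ∀ m, |a m| ≤ |c| := by
    intro m
    rw [hγk, Matrix.mulVec_single_one]
    exact (hk m i).trans (le_abs_self c)
  have hb_abs : ∀ m, |b m| ≤ D := by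
    intro m
    have e : b = μ • ((γ : indefSO p (p + q + r))⁻¹.val.val *ᵥ v)
        - (μ * (l * (1 + ‖y‖ ^ 2))) • a := by
      rw [hb, ha, hvu]
      simp only [Matrix.mulVec_add, Matrix.mulVec_smul]
      module
    have h1 : |((γ : indefSO p (p + q + r))⁻¹.val.val *ᵥ v) m| ≤ 1 + δ⁻¹ := by
      have h2 : ((γ : indefSO p (p + q + r))⁻¹.val.val *ᵥ v) m *
          ((γ : indefSO p (p + q + r))⁻¹.val.val *ᵥ v) m ≤ δ⁻¹ :=
        (Finset.single_le_sum (f := fun m => ((γ : indefSO p (p + q + r))⁻¹.val.val *ᵥ v) m *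
          ((γ : indefSO p (p + q + r))⁻¹.val.val *ᵥ v) m) (fun _ _ => mul_self_nonneg _)
          (Finset.mem_univ m)).trans hQ
      refine abs_le_of_sq_le_sq ?_ (by positivity)
      nlinarith [inv_pos.2 hδ]
    rw [e, hD]
    simp only [Pi.sub_apply, Pi.smul_apply, smul_eq_mul]
    refine (abs_sub _ _).trans ?_
    rw [abs_mul, abs_mul]
    have h3 := mul_le_mul hμ_abs h1 (abs_nonneg _) zero_le_one
    have h4 := mul_le_mul hμlss (ha_abs m) (abs_nonneg _) zero_le_one
    linarith
  have hD0 : 0 ≤ D := by positivity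
  have hD1 : |c| ≤ D := by
    have := inv_pos.2 hδ
    linarith
  have hmem : γ ∈ {γ : Γ | ∃ k ∈ bounded p (p + q + r) (N * (C₁ * c)),
      ∃ l ∈ bounded p (p + q + r) (N * ((1 + 4 * 1 ^ 2) * (1 + 2 * 1 ^ 2))),
        γ • (k : indefSO p (p + q + r) ⧸ indefSOsub p q r) = l} := by
    refine ⟨_, mul_mem_bounded (by positivity) (rotation_mem_bounded haa hbb hab hD0
      (fun m => (ha_abs m).trans hD1) hb_abs) hk, _,
      rotation_mem_bounded (signatureForm_single_single hi') hBu hBe zero_le_one he_abs hu_abs, ?_⟩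
    refine mk_eq_mk_iff (g := (γ : indefSO p (p + q + r)) * (rotation a b haa hbb hab * k)).2
      fun m hm => ?_
    rw [mul_mulVec, mul_mulVec]
    rcases eq_or_ne m i with rfl | hmi
    · rw [← hγk, rotation_mulVec_self, rotation_mulVec_self, hb, mulVec_inv_mulVec]
    · have hpm := (Nat.le_add_right p q).trans hm
      have hmj : m ≠ j := by rintro rfl; omega
      have hγm := hagree m hm
      rw [frame_mulVec_single_of_ne hi' hpm hmi.symm] at hγm
      have hkm : k.val.val *ᵥ Pi.single m 1
          = (γ : indefSO p (p + q + r))⁻¹.val.val *ᵥ Pi.single m 1 := by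
        conv_rhs => rw [← hγm, inv_mulVec_mulVec]
      have hum : signatureForm p (p + q + r) (μ • u) (Pi.single m 1) = 0 := by
        rw [signatureForm_comm, signatureForm_single hpm]
        simp [hu, hmi, hmj]
      rw [rotation_mulVec_of_orthogonal, hγm, rotation_mulVec_of_orthogonal]
      · rw [signatureForm_single hi']
        simp [hmi.symm]
      · exact hum
      · rw [hkm, ha, signatureForm_mulVec, signatureForm_comm, hf,
          signatureForm_single_hyperboloidLift_of_ne hpm hmi.symm]
      · rw [hkm, hb, signatureForm_mulVec, hum]
  have hγC := hC ⟨γ, hmem, rfl⟩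
  have hf_abs := mul_mem_bounded hC0 hγC hk i i
  have hfi : ((γ : indefSO p (p + q + r)) * k).val.val i i = s := by
    have h1 := congrFun (hagree i hi) i
    rw [← mul_mulVec, frame_mulVec_single, Matrix.mulVec_single_one] at h1
    refine h1.trans ?_
    simp [hyperboloidLift, embedPositive_apply_of_le y hi', hs]
  rw [hfi] at hf_abs
  have h1 : ‖y‖ ≤ s := Real.le_sqrt_of_sq_le (by linarith)
  linarith [le_abs_self s, le_abs_self (N * (C * c))]

end indefSO

namespace indefSO

/-- A cocompact action on `SO(p,q+r)/SO(p,q)` has a fundamental domain with bounded entries. -/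
lemma exists_forall_exists_mem_bounded {p q r : ℕ} (Γ : Subgroup (indefSO p (p + q + r)))
    [CompactSpace (MulAction.orbitRel.Quotient Γ (indefSO p (p + q + r) ⧸ indefSOsub p q r))] :
    ∃ c : ℝ, ∀ g : indefSO p (p + q + r), ∃ γ : Γ, ∃ k ∈ bounded p (p + q + r) c,
      γ • (k : indefSO p (p + q + r) ⧸ indefSOsub p q r) = g := by
  obtain ⟨n, hn⟩ := exists_forall_exists_smul_mk_eq_of_compactSpace
    (Γ := Γ) (H := indefSOsub p q r)
    (U := fun n : ℕ => {g | ∀ a b, |g.val.val a b| < n})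
    (fun n => by
      simp only [Set.ofPred_forall]
      exact isOpen_iInter_of_finite fun a => isOpen_iInter_of_finite fun b =>
        isOpen_lt (continuous_val.matrix_elem a b).abs continuous_const)
    (fun m n hmn g hg a b => (hg a b).trans_le (Nat.cast_le.2 hmn))
    (fun g => by
      obtain ⟨C, -, hC⟩ := exists_subset_bounded (isCompact_singleton (x := g))
      obtain ⟨n, hn⟩ := exists_nat_gt C
      exact ⟨n, fun a b => (hC rfl a b).trans_lt hn⟩)
  refine ⟨n, fun g => ?_⟩
  obtain ⟨γ, k, hk, hγ⟩ := hn g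
  exact ⟨γ, k, fun a b => (hk a b).le, hγ⟩

end indefSO

/-- **No compact Clifford–Klein forms for `SO(p,q+r)/SO(p,q)`, `p` odd.**
If `p` is odd and `q, r > 0`, there is no discrete subgroup `Γ` of `G = SO(p, q+r)` acting
properly discontinuously and cocompactly on the homogeneous space `G/H`,
where `H` is the standard copy of `SO(p,q)`. -/
theorem no_compact_CliffordKlein_form_indefSO (p q r : ℕ) (hp : 0 < p) (hq : 0 < q)
    (hr : 0 < r) (hodd : Odd p) :
    ¬ ∃ Γ : Subgroup ↥(indefSO p (p + q + r)), DiscreteTopology ↥Γ ∧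
      ProperlyDiscontinuousSMul ↥Γ (↥(indefSO p (p + q + r)) ⧸ indefSOsub p q r) ∧
      CompactSpace (MulAction.orbitRel.Quotient ↥Γ
        (↥(indefSO p (p + q + r)) ⧸ indefSOsub p q r)) := by
  rintro ⟨Γ, -, hPD, hcpt⟩
  obtain ⟨c, hcov⟩ := indefSO.exists_forall_exists_mem_bounded (p := p) (q := q) (r := r) Γ
  have hi : p + q ≤ ((⟨p + q, by omega⟩ : Fin (p + q + r)) : ℕ) := le_rfl
  have hj : p ≤ ((⟨p, by omega⟩ : Fin (p + q + r)) : ℕ) := le_rfl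
  have hjq : ((⟨p, by omega⟩ : Fin (p + q + r)) : ℕ) < p + q := Nat.lt_add_of_pos_right hq
  obtain ⟨δ, hδ, hne⟩ := indefSO.exists_forall_nonempty_admissible hcov hi hj
    (by simpa [Fin.ext_iff] using hq.ne')
  obtain ⟨w, hw⟩ := exists_contMDiffMap_forall_mem_convex_of_local_const
    (I := modelWithCornersSelf ℝ (EuclideanSpace ℝ (Fin p))) (n := 1)
    (indefSO.convex_admissible hδ.le _) fun y =>
      (hne y).imp fun _ => indefSO.eventually_mem_admissible _
  obtain ⟨R, hR, hRw⟩ := indefSO.exists_forall_smul_mem_admissible_norm_lt hδ hcov hi hj hjq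
  obtain ⟨x, hx, a, hax⟩ := exists_eq_smul_of_contDiff
    (by rwa [finrank_euclideanSpace_fin]) w.contMDiff.contDiff hR
  exact (hRw x a (hax ▸ hw x)).not_ge hx
end
end
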